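/- arXiv:2302.11024 — 9 statements merged into one kernel-verified Lean document; each statement's English description precedes it below -/
import Mathlib

section
/- Let d ≥ 1 and let f : (0,∞) → ℝ be continuously differentiable with f(1) = 0. Suppose that for every c > 0 and every smooth everywhere-positive probability density q on ℝ^d, the difference D_f[ρ‖c·q] − D_f[ρ‖q] takes the same value for all smooth everywhere-positive probability densities ρ such that the ratio ρ/q is bounded above and below by positive constants (for such ρ both integrals are finite). Then there exist constants a, b ∈ ℝ such that f(y) = a·y·log(y) + b·(y − 1) for all y > 0; consequently, for all such ρ and q, D_f[ρ‖q] = a·KL[ρ‖q], i.e. the KL divergence is, up to a scalar factor, the only f-divergence whose value changes by a ρ-independent constant when the second argument is rescaled. -/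
open MeasureTheory

/-- A smooth, everywhere-positive probability density on `ℝ^d`. -/
def IsSmoothDensity {d : ℕ} (ρ : (Fin d → ℝ) → ℝ) : Prop :=
  ContDiff ℝ (⊤ : ℕ∞) ρ ∧ (∀ θ, 0 < ρ θ) ∧ (∫ θ : Fin d → ℝ, ρ θ) = 1

/-- The ratio `ρ/q` is bounded above and below by positive constants. -/
def BoundedRatio {d : ℕ} (ρ q : (Fin d → ℝ) → ℝ) : Prop :=
  ∃ m M : ℝ, 0 < m ∧ 0 < M ∧ ∀ θ, m ≤ ρ θ / q θ ∧ ρ θ / q θ ≤ M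

open Filter Topology

/-- The standard Gaussian density on `ℝ^d`. -/
noncomputable def stdGaussianDensity {d : ℕ} (θ : Fin d → ℝ) : ℝ :=
  ∏ i, ProbabilityTheory.gaussianPDFReal 0 1 (θ i)

lemma isSmoothDensity_stdGaussianDensity {d : ℕ} :
    IsSmoothDensity (stdGaussianDensity (d := d)) := by
  refine ⟨?_, fun θ => Finset.prod_pos fun i _ =>
    ProbabilityTheory.gaussianPDFReal_pos _ _ _ one_ne_zero, ?_⟩
  · unfold stdGaussianDensity ProbabilityTheory.gaussianPDFReal
    fun_prop
  · unfold stdGaussianDensity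
    rw [integral_fintype_prod_volume_eq_pow,
      ProbabilityTheory.integral_gaussianPDFReal_eq_one _ one_ne_zero, one_pow]

lemma stdGaussianDensity_neg {d : ℕ} (θ : Fin d → ℝ) :
    stdGaussianDensity (-θ) = stdGaussianDensity θ := by
  simp [stdGaussianDensity, ProbabilityTheory.gaussianPDFReal]

lemma IsSmoothDensity.integrable {d : ℕ} {ρ : (Fin d → ℝ) → ℝ} (h : IsSmoothDensity ρ) :
    Integrable ρ :=
  Integrable.of_integral_ne_zero (by rw [h.2.2]; exact one_ne_zero)

/-- Against an even density, a function with `S θ + S (-θ) = s` has integral `s / 2`. -/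
lemma two_mul_integral_mul_of_add_neg {d : ℕ} {g S : (Fin d → ℝ) → ℝ} {s : ℝ}
    (hg : ∀ θ, g (-θ) = g θ) (hgS : Integrable fun θ => g θ * S θ)
    (hS : ∀ᵐ θ, S θ + S (-θ) = s) :
    2 * ∫ θ, g θ * S θ = s * ∫ θ, g θ := by
  have h1 : ∫ θ, g θ * S (-θ) = ∫ θ, g θ * S θ := by
    rw [← integral_neg_eq_self (fun θ => g θ * S θ)]
    simp only [hg]
  have h2 : Integrable fun θ => g θ * S (-θ) := by
    simpa only [hg] using hgS.comp_neg
  rw [two_mul]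
  nth_rewrite 2 [← h1]
  rw [← integral_add hgS h2, ← integral_const_mul]
  refine integral_congr_ae ?_
  filter_upwards [hS] with θ hθ
  rw [← hθ]; ring

/-- Interpolation between `a` on `{θ i < 0}` and `b` on `{0 < θ i}`, sharper as `n` grows. -/
noncomputable def sigmoidWeight {d : ℕ} (i : Fin d) (a b : ℝ) (n : ℕ) (θ : Fin d → ℝ) : ℝ :=
  a * (1 - Real.sigmoid (n * θ i)) + b * Real.sigmoid (n * θ i)

section sigmoidWeight

variable {d : ℕ} (i : Fin d) {a b : ℝ} (n : ℕ)

lemma contDiff_sigmoidWeight : ContDiff ℝ (⊤ : ℕ∞) (sigmoidWeight i a b n) := by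
  have h : ContDiff ℝ (⊤ : ℕ∞) Real.sigmoid := contDiff_sigmoid.of_le le_top
  have h' : ContDiff ℝ (⊤ : ℕ∞) fun θ : Fin d → ℝ => Real.sigmoid (n * θ i) :=
    h.comp (by fun_prop)
  unfold sigmoidWeight
  fun_prop

lemma sigmoidWeight_pos (ha : 0 < a) (hb : 0 < b) (θ : Fin d → ℝ) :
    0 < sigmoidWeight i a b n θ :=
  add_pos (mul_pos ha (sub_pos.2 (Real.sigmoid_lt_one _))) (mul_pos hb (Real.sigmoid_pos _))

lemma sigmoidWeight_le_of_le {a' b' : ℝ} (ha : a ≤ a') (hb : b ≤ b') (θ : Fin d → ℝ) :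
    sigmoidWeight i a b n θ ≤ sigmoidWeight i a' b' n θ :=
  add_le_add (mul_le_mul_of_nonneg_right ha (sub_nonneg.2 (Real.sigmoid_le_one _)))
    (mul_le_mul_of_nonneg_right hb (Real.sigmoid_nonneg _))

lemma sigmoidWeight_const_mul (m : ℝ) (θ : Fin d → ℝ) :
    sigmoidWeight i (m * a) (m * b) n θ = m * sigmoidWeight i a b n θ := by
  unfold sigmoidWeight; ring

lemma sigmoidWeight_self (θ : Fin d → ℝ) : sigmoidWeight i a a n θ = a := by
  unfold sigmoidWeight; ring

lemma sigmoidWeight_add_neg (θ : Fin d → ℝ) :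
    sigmoidWeight i a b n θ + sigmoidWeight i a b n (-θ) = a + b := by
  simp only [sigmoidWeight, Pi.neg_apply, mul_neg, Real.sigmoid_neg]; ring

lemma sigmoidWeight_le_one (ha : 0 < a) (hb : 0 < b) (hab : a + b = 1) (θ : Fin d → ℝ) :
    sigmoidWeight i a b n θ ≤ 1 :=
  (sigmoidWeight_le_of_le i n (by linarith) (by linarith) θ).trans_eq
    (sigmoidWeight_self i n θ)

lemma tendsto_sigmoidWeight {θ : Fin d → ℝ} (hθ : θ i ≠ 0) :
    Tendsto (fun n => sigmoidWeight i a b n θ) atTop (𝓝 (if 0 < θ i then b else a)) := by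
  unfold sigmoidWeight
  split_ifs with h
  · have : Tendsto (fun n : ℕ => Real.sigmoid (n * θ i)) atTop (𝓝 1) :=
      Real.tendsto_sigmoid_atTop.comp (tendsto_natCast_atTop_atTop.atTop_mul_const h)
    simpa using ((this.const_sub 1).const_mul a).add (this.const_mul b)
  · have : Tendsto (fun n : ℕ => Real.sigmoid (n * θ i)) atTop (𝓝 0) :=
      Real.tendsto_sigmoid_atBot.comp
        (tendsto_natCast_atTop_atTop.atTop_mul_const_of_neg (lt_of_le_of_ne (not_lt.1 h) hθ))
    simpa using ((this.const_sub 1).const_mul a).add (this.const_mul b)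

/-- A smooth density giving the two half-spaces `{θ i < 0}`, `{0 < θ i}` masses approaching
`a` and `b`. -/
noncomputable def halfSpaceDensity (a b : ℝ) (θ : Fin d → ℝ) : ℝ :=
  2 * stdGaussianDensity θ * sigmoidWeight i a b n θ

lemma isSmoothDensity_halfSpaceDensity (ha : 0 < a) (hb : 0 < b) (hab : a + b = 1) :
    IsSmoothDensity (halfSpaceDensity i n a b) := by
  have hg := isSmoothDensity_stdGaussianDensity (d := d)
  have hw := contDiff_sigmoidWeight i (a := a) (b := b) n
  refine ⟨?_, fun θ => mul_pos (mul_pos two_pos (hg.2.1 θ)) (sigmoidWeight_pos i n ha hb θ), ?_⟩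
  · have := hg.1
    unfold halfSpaceDensity
    fun_prop
  · have hint : Integrable fun θ => stdGaussianDensity θ * sigmoidWeight i a b n θ :=
      hg.integrable.mul_bdd (c := 1) hw.continuous.aestronglyMeasurable
        (ae_of_all _ fun θ => by
          rw [Real.norm_of_nonneg (sigmoidWeight_pos i n ha hb θ).le]
          exact sigmoidWeight_le_one i n ha hb hab θ)
    have := two_mul_integral_mul_of_add_neg stdGaussianDensity_neg hint
      (ae_of_all _ (sigmoidWeight_add_neg i n))
    simp only [halfSpaceDensity, mul_assoc]
    rw [integral_const_mul, this, hab, hg.2.2, one_mul]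

variable {α β : ℝ}

lemma halfSpaceDensity_div (θ : Fin d → ℝ) :
    halfSpaceDensity i n α β θ / halfSpaceDensity i n a b θ =
      sigmoidWeight i α β n θ / sigmoidWeight i a b n θ :=
  mul_div_mul_left _ _ (mul_pos two_pos (isSmoothDensity_stdGaussianDensity.2.1 θ)).ne'

lemma sigmoidWeight_div_mem_Icc (ha : 0 < a) (hb : 0 < b) (θ : Fin d → ℝ) :
    sigmoidWeight i α β n θ / sigmoidWeight i a b n θ ∈
      Set.Icc (min (α / a) (β / b)) (max (α / a) (β / b)) := by
  have hw := sigmoidWeight_pos i n ha hb θ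
  constructor
  · rw [le_div_iff₀ hw, ← sigmoidWeight_const_mul]
    exact sigmoidWeight_le_of_le i n ((le_div_iff₀ ha).1 (min_le_left _ _))
      ((le_div_iff₀ hb).1 (min_le_right _ _)) θ
  · rw [div_le_iff₀ hw, ← sigmoidWeight_const_mul]
    exact sigmoidWeight_le_of_le i n ((div_le_iff₀ ha).1 (le_max_left _ _))
      ((div_le_iff₀ hb).1 (le_max_right _ _)) θ

lemma boundedRatio_halfSpaceDensity (ha : 0 < a) (hb : 0 < b) (hα : 0 < α) (hβ : 0 < β) :
    BoundedRatio (halfSpaceDensity i n α β) (halfSpaceDensity i n a b) :=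
  ⟨min (α / a) (β / b), max (α / a) (β / b), lt_min (div_pos hα ha) (div_pos hβ hb),
    lt_max_of_lt_left (div_pos hα ha), fun θ => by
      rw [halfSpaceDensity_div]; exact sigmoidWeight_div_mem_Icc i n ha hb θ⟩

end sigmoidWeight

/-- The divergences of the half-space densities converge to the two-point divergence. -/
lemma tendsto_integral_halfSpaceDensity {d : ℕ} (i : Fin d) {a b α β : ℝ} (ha : 0 < a)
    (hb : 0 < b) (hab : a + b = 1) (hα : 0 < α) (hβ : 0 < β) {φ : ℝ → ℝ}
    (hφ : ContinuousOn φ (Set.Ioi 0)) :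
    Tendsto (fun n => ∫ θ, halfSpaceDensity i n a b θ *
        φ (halfSpaceDensity i n α β θ / halfSpaceDensity i n a b θ)) atTop
      (𝓝 (a * φ (α / a) + b * φ (β / b))) := by
  have hg := isSmoothDensity_stdGaussianDensity (d := d)
  have hα' := div_pos hα ha
  have hβ' := div_pos hβ hb
  have hsub : Set.Icc (min (α / a) (β / b)) (max (α / a) (β / b)) ⊆ Set.Ioi 0 :=
    fun x hx => (lt_min hα' hβ').trans_le hx.1
  obtain ⟨C, hC⟩ := isCompact_Icc.exists_bound_of_continuousOn (hφ.mono hsub)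
  set S : (Fin d → ℝ) → ℝ := fun θ => if 0 < θ i then b * φ (β / b) else a * φ (α / a) with hS
  have hne : ∀ᵐ θ : Fin d → ℝ, θ i ≠ 0 := by
    have := Measure.pi_hyperplane (fun _ : Fin d => (volume : Measure ℝ)) i 0
    rw [ae_iff]
    simpa [volume_pi] using this
  have hSint : Integrable fun θ => stdGaussianDensity θ * S θ := by
    refine hg.integrable.mul_bdd (c := max ‖b * φ (β / b)‖ ‖a * φ (α / a)‖) ?_ ?_
    · exact (Measurable.ite (measurableSet_lt measurable_const (measurable_pi_apply i))
        measurable_const measurable_const).aestronglyMeasurable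
    · refine ae_of_all _ fun θ => ?_
      simp only [hS]
      split_ifs
      exacts [le_max_left _ _, le_max_right _ _]
  have hlim : ∫ θ, 2 * stdGaussianDensity θ * S θ = a * φ (α / a) + b * φ (β / b) := by
    simp only [mul_assoc]
    rw [integral_const_mul, two_mul_integral_mul_of_add_neg stdGaussianDensity_neg hSint
      (s := a * φ (α / a) + b * φ (β / b)), hg.2.2, mul_one]
    filter_upwards [hne] with θ hθ
    simp only [hS, Pi.neg_apply, Left.neg_pos_iff]
    rcases hθ.lt_or_gt with h | h
    · rw [if_neg h.not_gt, if_pos h]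
    · rw [if_pos h, if_neg h.not_gt]; ring
  rw [← hlim]
  simp only [halfSpaceDensity_div]
  refine tendsto_integral_of_dominated_convergence (fun θ => 2 * stdGaussianDensity θ * C) ?_
    ((hg.integrable.const_mul 2).mul_const C) ?_ ?_
  · intro n
    have hq := isSmoothDensity_halfSpaceDensity i n ha hb hab
    refine (hq.1.continuous.mul (hφ.comp_continuous
      ((contDiff_sigmoidWeight i n).continuous.div (contDiff_sigmoidWeight i n).continuous
        fun θ => (sigmoidWeight_pos i n ha hb θ).ne') fun θ => ?_)).aestronglyMeasurable
    exact div_pos (sigmoidWeight_pos i n hα hβ θ) (sigmoidWeight_pos i n ha hb θ)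
  · refine fun n => ae_of_all _ fun θ => ?_
    have hq := (isSmoothDensity_halfSpaceDensity i n ha hb hab).2.1 θ
    rw [norm_mul, Real.norm_of_nonneg hq.le]
    refine mul_le_mul ?_ (hC _ (sigmoidWeight_div_mem_Icc i n ha hb θ)) (norm_nonneg _)
      (mul_pos two_pos (hg.2.1 θ)).le
    exact mul_le_of_le_one_right (mul_pos two_pos (hg.2.1 θ)).le
      (sigmoidWeight_le_one i n ha hb hab θ)
  · filter_upwards [hne] with θ hθ
    have ha' := tendsto_sigmoidWeight i (a := a) (b := b) hθ
    have hα'' := tendsto_sigmoidWeight i (a := α) (b := β) hθ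
    simp only [halfSpaceDensity, mul_assoc, hS]
    refine (Tendsto.const_mul _ (?_ : Tendsto _ _ (𝓝 _))).const_mul _
    split_ifs at ha' hα'' ⊢
    · exact ha'.mul ((hφ.continuousAt (Ioi_mem_nhds hβ')).tendsto.comp (hα''.div ha' hb.ne'))
    · exact ha'.mul ((hφ.continuousAt (Ioi_mem_nhds hα')).tendsto.comp (hα''.div ha' (ne_of_gt ha)))

/-- A function on `(0, ∞)` whose weighted two-point means with barycentre `1` all equal its value
at `1` is affine. -/
lemma exists_eq_add_mul_of_two_point_mean {h : ℝ → ℝ}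
    (hh : ∀ a b α β : ℝ, 0 < a → 0 < b → 0 < α → 0 < β → a + b = 1 → α + β = 1 →
      a * h (α / a) + b * h (β / b) = h 1) :
    ∃ A : ℝ, ∀ y, 0 < y → h y = h 1 + A * (y - 1) := by
  have key : ∀ y z, 0 < y → y < 1 → 1 < z → (h y - h 1) * (z - 1) + (h z - h 1) * (1 - y) = 0 := by
    intro y z hy hy1 hz
    have hzy : 0 < z - y := by linarith
    have ha : 0 < (z - 1) / (z - y) := div_pos (by linarith) hzy
    have hb : 0 < (1 - y) / (z - y) := div_pos (by linarith) hzy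
    have hz0 : 0 < z := by linarith
    have := hh _ _ ((z - 1) / (z - y) * y) ((1 - y) / (z - y) * z) ha hb (mul_pos ha hy)
      (mul_pos hb hz0) (by field_simp; ring) (by field_simp; ring)
    rw [mul_div_cancel_left₀ _ ha.ne', mul_div_cancel_left₀ _ hb.ne'] at this
    field_simp at this
    linarith
  refine ⟨h 2 - h 1, fun y hy => ?_⟩
  rcases lt_trichotomy y 1 with h1 | rfl | h1
  · linarith [key y 2 hy h1 one_lt_two]
  · ring
  · linarith [key (1 / 2) y (by norm_num) (by norm_num) h1,
      congrArg (· * (y - 1)) (key (1 / 2) 2 (by norm_num) (by norm_num) one_lt_two)]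

/-- If rescaling the argument shifts a continuous function on `(0, ∞)` by a constant, the function
is affine in `log`. -/
lemma exists_eq_mul_log_add_of_rescale {g : ℝ → ℝ} (hg : ContinuousOn g (Set.Ioi 0))
    (h : ∀ c, 0 < c → ∃ A, ∀ y, 0 < y → g (c * y) - g y = A) :
    ∃ a : ℝ, ∀ y, 0 < y → g y = a * Real.log y + g 1 := by
  have hadd : ∀ s t, g (Real.exp (s + t)) - g 1 =
      (g (Real.exp s) - g 1) + (g (Real.exp t) - g 1) := by
    intro s t
    obtain ⟨A, hA⟩ := h (Real.exp s) (Real.exp_pos s)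
    have h1 := hA 1 one_pos
    have h2 := hA (Real.exp t) (Real.exp_pos t)
    rw [mul_one] at h1
    rw [Real.exp_add]
    linarith
  let G : ℝ →+ ℝ := AddMonoidHom.mk' (fun t => g (Real.exp t) - g 1) hadd
  have hG : Continuous G :=
    (hg.comp_continuous Real.continuous_exp Real.exp_pos).sub continuous_const
  refine ⟨G 1, fun y hy => ?_⟩
  have h1 : G (Real.log y • (1 : ℝ)) = Real.log y • G 1 :=
    (G.toRealLinearMap hG).map_smul _ _
  have h2 : G (Real.log y) = g y - g 1 := by
    simp only [G, AddMonoidHom.mk'_apply, Real.exp_log hy]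
  rw [smul_eq_mul, mul_one, h2, smul_eq_mul] at h1
  linarith

/-- If `c f(y/c) - f(y)` is affine in `y` for each `c > 0`, then `f` generates a multiple of the
KL divergence. -/
lemma exists_eq_mul_log_of_rescale_affine {f : ℝ → ℝ} (hf : ContDiffOn ℝ 1 f (Set.Ioi 0))
    (hf1 : f 1 = 0)
    (h : ∀ c, 0 < c → ∃ A B : ℝ, ∀ y, 0 < y → c * f (y / c) - f y = B + A * (y - 1)) :
    ∃ a b : ℝ, ∀ y, 0 < y → f y = a * y * Real.log y + b * (y - 1) := by
  have hd : ∀ y, 0 < y → HasDerivAt f (deriv f y) y := fun y hy =>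
    ((hf.differentiableOn one_ne_zero).differentiableAt (Ioi_mem_nhds hy)).hasDerivAt
  obtain ⟨a, ha⟩ := exists_eq_mul_log_add_of_rescale (g := deriv f)
    (hf.continuousOn_deriv_of_isOpen isOpen_Ioi le_rfl) (fun c hc => by
      obtain ⟨A, B, hAB⟩ := h c⁻¹ (inv_pos.2 hc)
      refine ⟨A, fun y hy => ?_⟩
      have h1 : HasDerivAt (fun y => c⁻¹ * f (y / c⁻¹) - f y)
          (c⁻¹ * (deriv f (y / c⁻¹) * (1 / c⁻¹)) - deriv f y) y :=
        (((hd _ (div_pos hy (inv_pos.2 hc))).comp y ((hasDerivAt_id y).div_const _)).const_mul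
          _).sub (hd y hy)
      have h2 : HasDerivAt (fun y => B + A * (y - 1)) (A * 1) y :=
        (((hasDerivAt_id y).sub_const 1).const_mul A).const_add B
      have h3 := h1.unique (h2.congr_of_eventuallyEq
        (by filter_upwards [Ioi_mem_nhds hy] with z hz using hAB z hz))
      rw [div_inv_eq_mul, mul_comm y] at h3
      field_simp at h3
      linarith)
  set b := deriv f 1 - a
  refine ⟨a, b, fun y hy => ?_⟩
  have hF : ∀ y, 0 < y → HasDerivAt (fun y => f y - (a * (y * Real.log y) + b * (y - 1))) 0 y := by
    intro y hy
    have := (hd y hy).sub (((Real.hasDerivAt_mul_log hy.ne').const_mul a).add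
      (((hasDerivAt_id y).sub_const 1).const_mul b))
    refine this.congr_deriv ?_
    rw [ha y hy]
    simp only [b]; ring
  have := isOpen_Ioi.is_const_of_deriv_eq_zero isPreconnected_Ioi
    (fun y hy => (hF y hy).differentiableAt.differentiableWithinAt) (fun y hy => (hF y hy).deriv)
    hy (one_pos : (0 : ℝ) < 1)
  simp only [hf1, Real.log_one] at this
  linarith

/-- For `f y = a y log y + b (y - 1)` the `f`-divergence is `a` times the KL divergence. -/
lemma integral_mul_eq_mul_integral_mul_log {d : ℕ} {f : ℝ → ℝ} {a b : ℝ}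
    (hf : ∀ y : ℝ, 0 < y → f y = a * y * Real.log y + b * (y - 1)) {q ρ : (Fin d → ℝ) → ℝ}
    (hq : IsSmoothDensity q) (hρ : IsSmoothDensity ρ) (hr : BoundedRatio ρ q) :
    (∫ θ, q θ * f (ρ θ / q θ)) = a * ∫ θ, ρ θ * Real.log (ρ θ / q θ) := by
  obtain ⟨m, M, hm, -, hb⟩ := hr
  have hlog : Integrable fun θ => ρ θ * Real.log (ρ θ / q θ) := by
    refine hρ.integrable.mul_bdd (c := max |Real.log m| |Real.log M|)
      (((hρ.1.continuous.div hq.1.continuous fun θ => (hq.2.1 θ).ne').log fun θ =>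
        (div_pos (hρ.2.1 θ) (hq.2.1 θ)).ne').aestronglyMeasurable) (ae_of_all _ fun θ => ?_)
    exact abs_le_max_abs_abs (Real.log_le_log hm (hb θ).1)
      (Real.log_le_log (div_pos (hρ.2.1 θ) (hq.2.1 θ)) (hb θ).2)
  have hpt : ∀ θ, q θ * f (ρ θ / q θ) =
      a * (ρ θ * Real.log (ρ θ / q θ)) + b * (ρ θ - q θ) := by
    intro θ
    have hq0 := (hq.2.1 θ).ne'
    rw [hf _ (div_pos (hρ.2.1 θ) (hq.2.1 θ))]
    field_simp
  simp only [hpt]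
  rw [integral_add (hlog.const_mul a) (.const_mul (f := fun θ => ρ θ - q θ)
      (hρ.integrable.sub hq.integrable) b), integral_const_mul, integral_const_mul, integral_sub hρ.integrable hq.integrable,
    hρ.2.2, hq.2.2]
  ring

/-- Among all `f`-divergences (with `f` continuously differentiable on `(0,∞)` and `f 1 = 0`),
the KL divergence is, up to a scalar factor, the only one whose value changes by a
`ρ`-independent constant when the second argument is rescaled by a positive constant. -/
theorem kl_unique_f_divergence {d : ℕ} (hd : 1 ≤ d)
    (f : ℝ → ℝ) (hf : ContDiffOn ℝ 1 f (Set.Ioi 0)) (hf1 : f 1 = 0)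
    (hinv : ∀ c : ℝ, 0 < c → ∀ q : (Fin d → ℝ) → ℝ, IsSmoothDensity q →
      ∃ v : ℝ, ∀ ρ : (Fin d → ℝ) → ℝ, IsSmoothDensity ρ → BoundedRatio ρ q →
        (∫ θ, c * q θ * f (ρ θ / (c * q θ))) - (∫ θ, q θ * f (ρ θ / q θ)) = v) :
    ∃ a b : ℝ,
      (∀ y : ℝ, 0 < y → f y = a * y * Real.log y + b * (y - 1)) ∧
      (∀ q ρ : (Fin d → ℝ) → ℝ, IsSmoothDensity q → IsSmoothDensity ρ → BoundedRatio ρ q →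
        (∫ θ, q θ * f (ρ θ / q θ)) = a * ∫ θ, ρ θ * Real.log (ρ θ / q θ)) := by
  have hφ : ∀ c : ℝ, 0 < c → ContinuousOn (fun y => c * f (y / c)) (Set.Ioi 0) := fun c hc =>
    continuousOn_const.mul (hf.continuousOn.comp (by fun_prop) fun y hy => div_pos hy hc)
  have hmean : ∀ c : ℝ, 0 < c → ∀ a b α β : ℝ, 0 < a → 0 < b → 0 < α → 0 < β →
      a + b = 1 → α + β = 1 →
      a * (c * f (α / a / c) - f (α / a)) + b * (c * f (β / b / c) - f (β / b)) =
        c * f (1 / c) - f 1 := by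
    intro c hc a b α β ha hb hα hβ hab hαβ
    let i : Fin d := ⟨0, hd⟩
    have hcq : ∀ q r : ℝ, c * q * f (r / (c * q)) = q * (c * f (r / q / c)) := fun q r => by
      rw [div_div, mul_comm q c]; ring
    have hlim := (tendsto_integral_halfSpaceDensity i ha hb hab hα hβ (hφ c hc)).sub
      (tendsto_integral_halfSpaceDensity i ha hb hab hα hβ hf.continuousOn)
    rw [add_sub_add_comm, ← mul_sub, ← mul_sub] at hlim
    refine tendsto_nhds_unique hlim (tendsto_const_nhds.congr fun n => ?_)
    have hq := isSmoothDensity_halfSpaceDensity i n ha hb hab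
    obtain ⟨v, hv⟩ := hinv c hc _ hq
    have h1 := hv _ hq (boundedRatio_halfSpaceDensity i n ha hb ha hb)
    have h2 := hv _ (isSmoothDensity_halfSpaceDensity i n hα hβ hαβ)
      (boundedRatio_halfSpaceDensity i n ha hb hα hβ)
    simp only [hcq] at h1 h2
    simp only [div_self (hq.2.1 _).ne', integral_mul_const, hq.2.2, one_mul] at h1
    rw [h1, h2]
  obtain ⟨a, b, hab⟩ := exists_eq_mul_log_of_rescale_affine hf hf1 fun c hc => by
    obtain ⟨A, hA⟩ := exists_eq_add_mul_of_two_point_mean (h := fun y => c * f (y / c) - f y)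
      (hmean c hc)
    exact ⟨A, _, hA⟩
  exact ⟨a, b, hab, fun q ρ hq hρ hr => integral_mul_eq_mul_integral_mul_log hab hq hρ hr⟩
end

section
/- Let f : (0,∞) → ℝ be continuously differentiable, and suppose there exists a function g : (0,∞) → ℝ such that f'(y) − f'(c·y) = g(c) for all y > 0 and all c > 0. Then there exist constants a, b ∈ ℝ such that f'(y) = a·log(y) + b for all y > 0. -/
/-- If `f` is continuously differentiable on `(0,∞)` and there is a function `g` with
`f'(y) − f'(c·y) = g(c)` for all `y, c > 0`, then `f'(y) = a·log y + b` for some constants. -/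
theorem deriv_affine_log_of_scaling_invariance
    (f f' g : ℝ → ℝ)
    (hderiv : ∀ y : ℝ, 0 < y → HasDerivAt f (f' y) y)
    (hcont : ContinuousOn f' (Set.Ioi 0))
    (heq : ∀ y : ℝ, 0 < y → ∀ c : ℝ, 0 < c → f' y - f' (c * y) = g c) :
    ∃ a b : ℝ, ∀ y : ℝ, 0 < y → f' y = a * Real.log y + b := by
  have hadd : ∀ s t : ℝ,
      f' (Real.exp (s + t)) - f' 1 = (f' (Real.exp s) - f' 1) + (f' (Real.exp t) - f' 1) := by
    intro s t
    have h₁ := heq (Real.exp t) (Real.exp_pos t) (Real.exp s) (Real.exp_pos s)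
    have h₂ := heq 1 one_pos (Real.exp s) (Real.exp_pos s)
    rw [← Real.exp_add] at h₁
    rw [mul_one] at h₂
    linarith
  let φ : ℝ →+ ℝ := AddMonoidHom.mk' (fun t => f' (Real.exp t) - f' 1) hadd
  have hφ : Continuous φ :=
    (hcont.comp_continuous Real.continuous_exp Real.exp_pos).sub continuous_const
  refine ⟨φ 1, f' 1, fun y hy => ?_⟩
  have hlin : φ (Real.log y) = Real.log y * φ 1 := by
    simpa using map_real_smul φ hφ (Real.log y) 1
  have hval : φ (Real.log y) = f' y - f' 1 := by
    simp [φ, Real.exp_log hy]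
  linarith
end

section
/- Let ρ₀ and ρ_post be probability densities on ℝ^d, positive everywhere, satisfying assumptions (A1) and (A2). For t > 0 define Z(t) = ∫ ρ₀(θ)^{e^{−t}} · ρ_post(θ)^{1−e^{−t}} dθ and ρ_t(θ) = ρ₀(θ)^{e^{−t}} · ρ_post(θ)^{1−e^{−t}} / Z(t). Then: (i) 0 < Z(t) ≤ 1 and ρ_t is a probability density; (ii) θ ↦ (log ρ_post(θ) − log ρ_t(θ))·ρ_t(θ) is integrable; and (iii) for each fixed θ, the map t ↦ ρ_t(θ) is differentiable on (0,∞) with ∂_t ρ_t(θ) = ρ_t(θ)·(log ρ_post(θ) − log ρ_t(θ)) − ρ_t(θ)·∫ (log ρ_post(θ') − log ρ_t(θ'))·ρ_t(θ') dθ'; i.e. ρ_t solves the Fisher–Rao gradient flow of the KL divergence. -/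
open MeasureTheory

theorem abs_log_sub_log_le {a b M : ℝ} (ha : 0 < a) (hb : 0 < b)
    (h₁ : Real.exp (-M) ≤ a / b) (h₂ : a / b ≤ Real.exp M) :
    |Real.log b - Real.log a| ≤ M := by
  have hab := div_pos ha hb
  have e : Real.log (a / b) = Real.log a - Real.log b := Real.log_div ha.ne' hb.ne'
  have l₁ := (Real.le_log_iff_exp_le hab).2 h₁
  have l₂ := (Real.log_le_iff_le_exp hab).2 h₂
  rw [abs_le]
  constructor <;> linarith

theorem rpow_mul_rpow_one_sub_le_add {a b l : ℝ} (ha : 0 < a) (hb : 0 < b)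
    (hl₀ : 0 ≤ l) (hl₁ : l ≤ 1) : a ^ l * b ^ (1 - l) ≤ a + b := by
  have h := Real.geom_mean_le_arith_mean2_weighted hl₀ (sub_nonneg.2 hl₁) ha.le hb.le (by ring)
  nlinarith

theorem hasDerivAt_rpow_exp_neg_mul_rpow {a b : ℝ} (ha : 0 < a) (hb : 0 < b) (t : ℝ) :
    HasDerivAt (fun s => a ^ Real.exp (-s) * b ^ (1 - Real.exp (-s)))
      (Real.exp (-t) * (Real.log b - Real.log a) *
        (a ^ Real.exp (-t) * b ^ (1 - Real.exp (-t)))) t := by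
  have he : HasDerivAt (fun s : ℝ => Real.exp (-s)) (-Real.exp (-t)) t := by
    simpa using (hasDerivAt_neg t).exp
  refine ((he.const_rpow ha).mul ((he.const_sub 1).const_rpow hb)).congr_deriv ?_
  ring



/-- The explicit geometric-mixture curve `ρ_t ∝ ρ₀^{e^{−t}} ρ_post^{1−e^{−t}}` is well defined,
consists of probability densities, and solves the Fisher–Rao gradient flow of the KL
divergence, under assumptions (A1) and (A2). -/
theorem fisherRao_explicit_solution {d : ℕ}
    (ρ₀ ρpost : (Fin d → ℝ) → ℝ)
    (hρ₀m : Measurable ρ₀) (hρpostm : Measurable ρpost)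
    (hρ₀pos : ∀ θ, 0 < ρ₀ θ) (hρpostpos : ∀ θ, 0 < ρpost θ)
    (hρ₀int : (∫ θ, ρ₀ θ) = 1) (hρpostint : (∫ θ, ρpost θ) = 1)
    -- assumption (A1)
    (K : ℝ) (hK : 0 < K)
    (hA1 : ∀ θ : Fin d → ℝ,
      Real.exp (-(K * (1 + ∑ i, θ i ^ 2))) ≤ ρ₀ θ / ρpost θ ∧
      ρ₀ θ / ρpost θ ≤ Real.exp (K * (1 + ∑ i, θ i ^ 2)))
    -- assumption (A2)
    (B : ℝ) (hB : 0 < B)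
    (hA2₀ : Integrable (fun θ => (∑ i, θ i ^ 2) * ρ₀ θ) ∧
      (∫ θ, (∑ i, θ i ^ 2) * ρ₀ θ) ≤ B)
    (hA2post : Integrable (fun θ => (∑ i, θ i ^ 2) * ρpost θ) ∧
      (∫ θ, (∑ i, θ i ^ 2) * ρpost θ) ≤ B)
    -- the normalization constant and the curve of densities
    (Z : ℝ → ℝ)
    (hZ : ∀ t, Z t = ∫ θ, ρ₀ θ ^ Real.exp (-t) * ρpost θ ^ (1 - Real.exp (-t)))
    (ρ : ℝ → (Fin d → ℝ) → ℝ)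
    (hρ : ∀ t θ, ρ t θ = ρ₀ θ ^ Real.exp (-t) * ρpost θ ^ (1 - Real.exp (-t)) / Z t) :
    ∀ t : ℝ, 0 < t →
      -- (i) normalization and density property
      (0 < Z t ∧ Z t ≤ 1 ∧ (∀ θ, 0 < ρ t θ) ∧ (∫ θ, ρ t θ) = 1) ∧
      -- (ii) integrability
      Integrable (fun θ => (Real.log (ρpost θ) - Real.log (ρ t θ)) * ρ t θ) ∧
      -- (iii) the Fisher–Rao gradient flow equation
      (∀ θ, HasDerivAt (fun s => ρ s θ)
        (ρ t θ * (Real.log (ρpost θ) - Real.log (ρ t θ)) -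
          ρ t θ * ∫ θ', (Real.log (ρpost θ') - Real.log (ρ t θ')) * ρ t θ') t) := by
  have hI₀ : Integrable ρ₀ := by
    by_contra h
    simp [integral_undef h] at hρ₀int
  have hIp : Integrable ρpost := by
    by_contra h
    simp [integral_undef h] at hρpostint
  set g : ℝ → (Fin d → ℝ) → ℝ :=
    fun s θ => ρ₀ θ ^ Real.exp (-s) * ρpost θ ^ (1 - Real.exp (-s)) with hg
  have hgm : ∀ s, Measurable (g s) := fun s =>
    (hρ₀m.pow_const _).mul (hρpostm.pow_const _)
  have hgpos : ∀ s θ, 0 < g s θ := fun s θ =>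
    mul_pos (Real.rpow_pos_of_pos (hρ₀pos θ) _) (Real.rpow_pos_of_pos (hρpostpos θ) _)
  have hexp : ∀ s : ℝ, 0 < s → Real.exp (-s) ≤ 1 := fun s hs => by
    rw [Real.exp_le_one_iff]; linarith
  have hgle : ∀ s, 0 < s → ∀ θ, g s θ ≤ ρ₀ θ + ρpost θ := fun s hs θ =>
    rpow_mul_rpow_one_sub_le_add (hρ₀pos θ) (hρpostpos θ) (Real.exp_pos _).le (hexp s hs)
  have hgint : ∀ s, 0 < s → Integrable (g s) := fun s hs =>
    (hI₀.add hIp).mono' (hgm s).aestronglyMeasurable (ae_of_all _ fun θ => by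
      rw [Real.norm_of_nonneg (hgpos s θ).le]; exact hgle s hs θ)
  have hlog : ∀ θ, |Real.log (ρpost θ) - Real.log (ρ₀ θ)| ≤ K * (1 + ∑ i, θ i ^ 2) := fun θ =>
    abs_log_sub_log_le (hρ₀pos θ) (hρpostpos θ) (hA1 θ).1 (hA1 θ).2
  intro t ht
  have hZpos : 0 < Z t := by
    rw [hZ, integral_pos_iff_support_of_nonneg (fun θ => (hgpos t θ).le) (hgint t ht)]
    have : Function.support (g t) = Set.univ :=
      Set.eq_univ_of_forall fun θ => (hgpos t θ).ne'
    rw [this]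
    exact Measure.measure_univ_pos.2 (NeZero.ne _)
  have hZle : Z t ≤ 1 := by
    rw [hZ]
    calc ∫ θ, g t θ
        ≤ ∫ θ, (Real.exp (-t) * ρ₀ θ + (1 - Real.exp (-t)) * ρpost θ) := by
          refine integral_mono (hgint t ht) ((hI₀.const_mul _).add (hIp.const_mul _)) fun θ => ?_
          exact Real.geom_mean_le_arith_mean2_weighted (Real.exp_pos _).le
            (sub_nonneg.2 (hexp t ht)) (hρ₀pos θ).le (hρpostpos θ).le (by ring)
      _ = 1 := by
          rw [integral_add (hI₀.const_mul _) (hIp.const_mul _), integral_const_mul,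
            integral_const_mul, hρ₀int, hρpostint]
          ring
  have hρg : ∀ s θ, ρ s θ = g s θ / Z s := hρ
  obtain ⟨hg'int, hZ'⟩ := hasDerivAt_integral_of_dominated_loc_of_deriv_le
    (μ := volume) (F := g)
    (F' := fun s θ => Real.exp (-s) * (Real.log (ρpost θ) - Real.log (ρ₀ θ)) * g s θ)
    (bound := fun θ => K * (1 + ∑ i, θ i ^ 2) * (ρ₀ θ + ρpost θ))
    (Ioi_mem_nhds ht)
    (Filter.Eventually.of_forall fun s => (hgm s).aestronglyMeasurable) (hgint t ht)
    (((hρpostm.log.sub hρ₀m.log).const_mul _).mul (hgm t)).aestronglyMeasurable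
    (ae_of_all _ fun θ s hs => by
      have hs' : 0 < s := hs
      rw [norm_mul, norm_mul, Real.norm_of_nonneg (Real.exp_pos _).le,
        Real.norm_of_nonneg (hgpos s θ).le, Real.norm_eq_abs]
      refine mul_le_mul ?_ (hgle s hs' θ) (hgpos s θ).le ((abs_nonneg _).trans (hlog θ))
      exact (mul_le_of_le_one_left (abs_nonneg _) (hexp s hs')).trans (hlog θ))
    (by
      refine (((hI₀.add hIp).add (hA2₀.1.add hA2post.1)).const_mul K).congr (ae_of_all _ fun θ => ?_)
      simp only [Pi.add_apply]
      ring)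
    (ae_of_all _ fun θ s _ => hasDerivAt_rpow_exp_neg_mul_rpow (hρ₀pos θ) (hρpostpos θ) s)
  have hZfun : Z = fun s => ∫ θ, g s θ := funext hZ
  rw [← hZfun] at hZ'
  have hρint : Integrable (ρ t) :=
    ((hgint t ht).div_const (Z t)).congr (ae_of_all _ fun θ => (hρg t θ).symm)
  have hρone : ∫ θ, ρ t θ = 1 := by
    simp only [hρg]
    rw [integral_div, ← hZ t, div_self hZpos.ne']
  have hlogρ : ∀ θ, Real.log (ρpost θ) - Real.log (ρ t θ) =
      Real.exp (-t) * (Real.log (ρpost θ) - Real.log (ρ₀ θ)) + Real.log (Z t) := fun θ => by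
    rw [hρ, Real.log_div (hgpos t θ).ne' hZpos.ne',
      Real.log_mul (Real.rpow_pos_of_pos (hρ₀pos θ) _).ne'
        (Real.rpow_pos_of_pos (hρpostpos θ) _).ne',
      Real.log_rpow (hρ₀pos θ), Real.log_rpow (hρpostpos θ)]
    ring
  have hsplit : (fun θ => (Real.log (ρpost θ) - Real.log (ρ t θ)) * ρ t θ) = fun θ =>
      Real.exp (-t) * (Real.log (ρpost θ) - Real.log (ρ₀ θ)) * g t θ / Z t +
        Real.log (Z t) * ρ t θ := by
    funext θ
    rw [hlogρ, hρg]
    ring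
  refine ⟨⟨hZpos, hZle, fun θ => by rw [hρg]; exact div_pos (hgpos t θ) hZpos, hρone⟩, ?_, ?_⟩
  · rw [hsplit]
    exact (hg'int.div_const _).add (hρint.const_mul _)
  · intro θ
    rw [hsplit, integral_add (hg'int.div_const _) (hρint.const_mul _), integral_div,
      integral_const_mul, hρone, hlogρ]
    simp only [hρg]
    refine ((hasDerivAt_rpow_exp_neg_mul_rpow (hρ₀pos θ) (hρpostpos θ) t).div hZ'
      hZpos.ne').congr_deriv ?_
    change (_ * g t θ * _ - g t θ * _) / _ = _
    field_simp
    ring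
end

section
/- Let ρ_post be a probability density on ℝ^d, positive everywhere, and let ρ : [0,∞) × ℝ^d → (0,∞) be such that ρ_t := ρ(t,·) is a probability density for every t, the map t ↦ ρ(t,θ) is differentiable on [0,∞) for every θ, the function θ ↦ (log ρ_post(θ) − log ρ_t(θ))·ρ_t(θ) is integrable for every t with t ↦ ∫ (log ρ_post − log ρ_t)·ρ_t dθ continuous, and ρ solves the Fisher–Rao gradient flow: ∂_t ρ_t(θ) = ρ_t(θ)·(log ρ_post(θ) − log ρ_t(θ)) − ρ_t(θ)·∫ (log ρ_post(θ') − log ρ_t(θ'))·ρ_t(θ') dθ' for all t ≥ 0 and θ. Assume ρ₀ := ρ(0,·) and ρ_post satisfy assumptions (A1) and (A2) with constants K, B > 0. Then for every t ≥ log((1+B)·K), KL[ρ_t‖ρ_post] = ∫ ρ_t(θ)·log(ρ_t(θ)/ρ_post(θ)) dθ ≤ (2 + B + e·B)·K·e^{−t}. -/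
open MeasureTheory

/-- Two solutions of `u' = -u + c` on `[0, ∞)` with the same forcing `c` approach each other
exactly like `e^{-t}`. -/
lemma sub_eq_exp_neg_mul_sub_of_hasDerivWithinAt {u v c : ℝ → ℝ}
    (hu : ∀ t, 0 ≤ t → HasDerivWithinAt u (-u t + c t) (Set.Ici 0) t)
    (hv : ∀ t, 0 ≤ t → HasDerivWithinAt v (-v t + c t) (Set.Ici 0) t) {t : ℝ} (ht : 0 ≤ t) :
    u t - v t = Real.exp (-t) * (u 0 - v 0) := by
  have hderiv : ∀ s ∈ Set.Ici (0 : ℝ),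
      HasDerivWithinAt (fun s => Real.exp s * (u s - v s)) 0 (Set.Ici 0) s := by
    intro s hs
    refine ((Real.hasDerivAt_exp s).hasDerivWithinAt.mul
      ((hu s hs).sub (hv s hs))).congr_deriv ?_
    simp only [Pi.sub_apply]
    ring
  have hconst : Real.exp t * (u t - v t) = Real.exp 0 * (u 0 - v 0) :=
    (convex_Ici (0 : ℝ)).is_const_of_fderivWithin_eq_zero (𝕜 := ℝ)
      (f := fun s => Real.exp s * (u s - v s))
      (fun s hs => (hderiv s hs).differentiableWithinAt)
      (fun s hs => by
        have h := (hderiv s hs).hasFDerivWithinAt.fderivWithin (uniqueDiffOn_Ici 0 s hs)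
        simpa using h)
      ht (le_refl (0 : ℝ))
  rw [Real.exp_zero, one_mul] at hconst
  rw [← hconst, ← mul_assoc, ← Real.exp_add, neg_add_cancel, Real.exp_zero, one_mul]

/-- Weighted AM-GM in exponential form. -/
lemma exp_mul_log_le {r l : ℝ} (hr : 0 < r) (hl0 : 0 ≤ l) (hl1 : l ≤ 1) :
    Real.exp (l * Real.log r) ≤ (1 - l) + l * r := by
  have h := convexOn_exp.2 (Set.mem_univ 0) (Set.mem_univ (Real.log r)) (sub_nonneg.2 hl1) hl0
    (by ring)
  simpa [Real.exp_log hr] using h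

/-- KL bound for the geometric interpolation `p₁ = e^a p^{1-l} p₀^l` of two densities whose
log-ratio is bounded by `K (1 + q)`, where `q` has mean at most `B` under both densities. -/
lemma integral_mul_log_div_le_of_log_div_eq {α : Type*} [MeasurableSpace α] {μ : Measure α}
    {p p₀ p₁ q : α → ℝ} {K B l a : ℝ} (hppos : ∀ x, 0 < p x) (hp₀pos : ∀ x, 0 < p₀ x)
    (hp₁pos : ∀ x, 0 < p₁ x) (hq : ∀ x, 0 ≤ q x)
    (hp : ∫ x, p x ∂μ = 1) (hp₁ : ∫ x, p₁ x ∂μ = 1)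
    (hqp : Integrable (fun x => q x * p x) μ) (hqpB : ∫ x, q x * p x ∂μ ≤ B)
    (hqp₀ : Integrable (fun x => q x * p₀ x) μ) (hqp₀B : ∫ x, q x * p₀ x ∂μ ≤ B)
    (hqm : AEStronglyMeasurable (fun x => q x * p₁ x) μ)
    (hlog : Integrable (fun x => p₁ x * Real.log (p₁ x / p x)) μ)
    (hl0 : 0 ≤ l) (hl1 : l ≤ 1) (hK : 0 ≤ K)
    (habs : ∀ x, |Real.log (p₀ x / p x)| ≤ K * (1 + q x))
    (hratio : ∀ x, Real.log (p₁ x / p x) = l * Real.log (p₀ x / p x) + a)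
    (hB : 0 ≤ B) (hsmall : (1 + B) * K * l ≤ 1) :
    ∫ x, p₁ x * Real.log (p₁ x / p x) ∂μ ≤ (2 + B + Real.exp 1 * B) * K * l := by
  have hpint : Integrable p μ := by
    by_contra h
    simp [integral_undef h] at hp
  have hp₁int : Integrable p₁ μ := by
    by_contra h
    simp [integral_undef h] at hp₁
  have hlK : 0 ≤ l * K := mul_nonneg hl0 hK
  have ha : a ≤ l * K * (1 + B) := by
    have hle : ∫ x, ((1 + a - l * K) * p x - l * K * (q x * p x)) ∂μ ≤ ∫ x, p₁ x ∂μ := by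
      refine integral_mono ((hpint.const_mul _).sub (hqp.const_mul _)) hp₁int fun x => ?_
      have hexp := Real.add_one_le_exp (Real.log (p₁ x / p x))
      rw [Real.exp_log (div_pos (hp₁pos x) (hppos x)), le_div_iff₀ (hppos x), hratio x] at hexp
      have hlow := mul_le_mul_of_nonneg_left (abs_le.1 (habs x)).1 hl0
      have := mul_le_mul_of_nonneg_right hlow (hppos x).le
      dsimp only
      linarith
    rw [integral_sub (hpint.const_mul _) (hqp.const_mul _), integral_const_mul,
      integral_const_mul, hp, hp₁] at hle
    have := mul_le_mul_of_nonneg_left hqpB hlK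
    linarith
  have ha1 : Real.exp a ≤ Real.exp 1 := Real.exp_le_exp.2 (by linarith)
  have hbound : ∀ x, q x * p₁ x ≤
      Real.exp a * ((1 - l) * (q x * p x) + l * (q x * p₀ x)) := by
    intro x
    have hp₁x : p₁ x = p x * (Real.exp (l * Real.log (p₀ x / p x)) * Real.exp a) := by
      rw [← Real.exp_add, ← hratio x, Real.exp_log (div_pos (hp₁pos x) (hppos x)),
        mul_div_cancel₀ _ (hppos x).ne']
    have hamgm := exp_mul_log_le (div_pos (hp₀pos x) (hppos x)) hl0 hl1
    calc q x * p₁ x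
        = q x * p x * Real.exp a * Real.exp (l * Real.log (p₀ x / p x)) := by rw [hp₁x]; ring
      _ ≤ q x * p x * Real.exp a * ((1 - l) + l * (p₀ x / p x)) :=
          mul_le_mul_of_nonneg_left hamgm
            (mul_nonneg (mul_nonneg (hq x) (hppos x).le) (Real.exp_pos a).le)
      _ = Real.exp a * ((1 - l) * (q x * p x) + l * (q x * p₀ x)) := by
          have := (hppos x).ne'
          field_simp
  have hdom := ((hqp.const_mul (1 - l)).add (hqp₀.const_mul l)).const_mul (Real.exp a)
  have hqp₁ : Integrable (fun x => q x * p₁ x) μ := by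
    refine hdom.mono' hqm (Filter.Eventually.of_forall fun x => ?_)
    rw [Real.norm_of_nonneg (mul_nonneg (hq x) (hp₁pos x).le)]
    exact hbound x
  have hmoment : ∫ x, q x * p₁ x ∂μ ≤ Real.exp 1 * B := by
    refine (integral_mono hqp₁ hdom hbound).trans ?_
    simp only [Pi.add_apply]
    rw [integral_const_mul, integral_add (hqp.const_mul _) (hqp₀.const_mul _),
      integral_const_mul, integral_const_mul]
    have h₁ := mul_le_mul_of_nonneg_left hqpB (sub_nonneg.2 hl1)
    have h₂ := mul_le_mul_of_nonneg_left hqp₀B hl0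
    calc _ ≤ Real.exp a * B := mul_le_mul_of_nonneg_left (by linarith) (Real.exp_pos a).le
      _ ≤ Real.exp 1 * B := mul_le_mul_of_nonneg_right ha1 hB
  have hle : ∫ x, p₁ x * Real.log (p₁ x / p x) ∂μ ≤
      ∫ x, ((l * K + a) * p₁ x + l * K * (q x * p₁ x)) ∂μ := by
    refine integral_mono hlog ((hp₁int.const_mul _).add (hqp₁.const_mul _)) fun x => ?_
    have hupp := mul_le_mul_of_nonneg_left (abs_le.1 (habs x)).2 hl0
    have := mul_le_mul_of_nonneg_right hupp (hp₁pos x).le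
    dsimp only
    rw [hratio x]
    linarith
  rw [integral_add (hp₁int.const_mul _) (hqp₁.const_mul _), integral_const_mul,
    integral_const_mul, hp₁] at hle
  have := mul_le_mul_of_nonneg_left hmoment hlK
  linarith

/-- Exponential convergence of the Fisher–Rao gradient flow of the KL divergence:
under assumptions (A1) and (A2), for `t ≥ log((1+B)K)` one has
`KL[ρ_t‖ρ_post] ≤ (2 + B + e·B)·K·e^{−t}`. -/
theorem fisherRao_convergence {d : ℕ}
    (ρpost : (Fin d → ℝ) → ℝ) (hpostm : Measurable ρpost)
    (hpostpos : ∀ θ, 0 < ρpost θ) (hpostint : (∫ θ, ρpost θ) = 1)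
    (ρ : ℝ → (Fin d → ℝ) → ℝ)
    (hρpos : ∀ t θ, 0 ≤ t → 0 < ρ t θ)
    (hρmeas : ∀ t, 0 ≤ t → Measurable (ρ t))
    (hρint : ∀ t, 0 ≤ t → (∫ θ, ρ t θ) = 1)
    (hInt : ∀ t, 0 ≤ t →
      Integrable (fun θ => (Real.log (ρpost θ) - Real.log (ρ t θ)) * ρ t θ))
    (hcont : ContinuousOn
      (fun t => ∫ θ, (Real.log (ρpost θ) - Real.log (ρ t θ)) * ρ t θ) (Set.Ici 0))
    -- the Fisher–Rao gradient flow equation, on [0,∞)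
    (hflow : ∀ t θ, 0 ≤ t → HasDerivWithinAt (fun s => ρ s θ)
      (ρ t θ * (Real.log (ρpost θ) - Real.log (ρ t θ)) -
        ρ t θ * ∫ θ', (Real.log (ρpost θ') - Real.log (ρ t θ')) * ρ t θ') (Set.Ici 0) t)
    -- assumption (A1)
    (K : ℝ) (hK : 0 < K)
    (hA1 : ∀ θ : Fin d → ℝ,
      Real.exp (-(K * (1 + ∑ i, θ i ^ 2))) ≤ ρ 0 θ / ρpost θ ∧
      ρ 0 θ / ρpost θ ≤ Real.exp (K * (1 + ∑ i, θ i ^ 2)))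
    -- assumption (A2)
    (B : ℝ) (hB : 0 < B)
    (hA2₀ : Integrable (fun θ => (∑ i, θ i ^ 2) * ρ 0 θ) ∧
      (∫ θ, (∑ i, θ i ^ 2) * ρ 0 θ) ≤ B)
    (hA2post : Integrable (fun θ => (∑ i, θ i ^ 2) * ρpost θ) ∧
      (∫ θ, (∑ i, θ i ^ 2) * ρpost θ) ≤ B) :
    ∀ t : ℝ, 0 ≤ t → Real.log ((1 + B) * K) ≤ t →
      (∫ θ, ρ t θ * Real.log (ρ t θ / ρpost θ)) ≤
        (2 + B + Real.exp 1 * B) * K * Real.exp (-t) := by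
  intro t ht hlogt
  have hdiv : ∀ s θ, 0 ≤ s →
      Real.log (ρ s θ / ρpost θ) = Real.log (ρ s θ) - Real.log (ρpost θ) := fun s θ hs =>
    Real.log_div (hρpos s θ hs).ne' (hpostpos θ).ne'
  have hode : ∀ θ s, 0 ≤ s →
      HasDerivWithinAt (fun s => Real.log (ρ s θ) - Real.log (ρpost θ))
        (-(Real.log (ρ s θ) - Real.log (ρpost θ)) +
          -∫ θ', (Real.log (ρpost θ') - Real.log (ρ s θ')) * ρ s θ') (Set.Ici 0) s := by
    intro θ s hs
    have hne := (hρpos s θ hs).ne'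
    refine (((hflow s θ hs).log hne).sub_const (Real.log (ρpost θ))).congr_deriv ?_
    rw [← mul_sub, mul_div_cancel_left₀ _ hne]
    ring
  have hratio : ∀ θ, Real.log (ρ t θ / ρpost θ) =
      Real.exp (-t) * Real.log (ρ 0 θ / ρpost θ) +
        (Real.log (ρ t 0 / ρpost 0) - Real.exp (-t) * Real.log (ρ 0 0 / ρpost 0)) := by
    intro θ
    have h := sub_eq_exp_neg_mul_sub_of_hasDerivWithinAt (hode θ) (hode 0) ht
    rw [← hdiv t θ ht, ← hdiv t 0 ht, ← hdiv 0 θ le_rfl, ← hdiv 0 0 le_rfl] at h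
    linarith
  have hsq : ∀ θ : Fin d → ℝ, 0 ≤ ∑ i, θ i ^ 2 := fun θ =>
    Finset.sum_nonneg fun i _ => sq_nonneg (θ i)
  have habs : ∀ θ, |Real.log (ρ 0 θ / ρpost θ)| ≤ K * (1 + ∑ i, θ i ^ 2) := by
    intro θ
    have hpos := div_pos (hρpos 0 θ le_rfl) (hpostpos θ)
    exact abs_le.2 ⟨(Real.le_log_iff_exp_le hpos).2 (hA1 θ).1,
      (Real.log_le_iff_le_exp hpos).2 (hA1 θ).2⟩
  have hKL : Integrable fun θ => ρ t θ * Real.log (ρ t θ / ρpost θ) := by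
    refine (hInt t ht).neg.congr (Filter.Eventually.of_forall fun θ => ?_)
    simp only [Pi.neg_apply, hdiv t θ ht]
    ring
  have hsmall : (1 + B) * K * Real.exp (-t) ≤ 1 := by
    rw [Real.exp_neg, ← div_eq_mul_inv, div_le_one (Real.exp_pos t)]
    exact (Real.log_le_iff_le_exp (by positivity)).1 hlogt
  have hqm : Measurable fun θ : Fin d → ℝ => (∑ i, θ i ^ 2) * ρ t θ :=
    (Finset.measurable_sum _ fun i _ => (measurable_pi_apply i).pow_const 2).mul (hρmeas t ht)
  exact integral_mul_log_div_le_of_log_div_eq hpostpos (fun θ => hρpos 0 θ le_rfl)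
    (fun θ => hρpos t θ ht) hsq hpostint (hρint t ht) hA2post.1 hA2post.2 hA2₀.1 hA2₀.2
    hqm.aestronglyMeasurable hKL (Real.exp_pos _).le (Real.exp_le_one_iff.2 (by linarith))
    hK.le habs hratio hB.le hsmall
end

section
/- Let ρ₀ be a probability density on ℝ^d and let Φ : ℝ^d → [0,∞) be measurable. For t > 0 define N(t) = ∫ e^{−t·Φ(θ)}·ρ₀(θ) dθ and ρ_t(θ) = e^{−t·Φ(θ)}·ρ₀(θ)/N(t). Then for every t > 0: (i) 0 < N(t) ≤ 1 and ρ_t is a probability density; (ii) θ ↦ Φ(θ)·ρ_t(θ) is integrable; and (iii) for every θ ∈ ℝ^d the map s ↦ ρ_s(θ) is differentiable at t with derivative ∂_t ρ_t(θ) = −ρ_t(θ)·(Φ(θ) − ∫ Φ(θ')·ρ_t(θ') dθ'). That is, the homotopy density e^{−tΦ}ρ₀/𝔼_{ρ₀}[e^{−tΦ}] solves the Fisher–Rao gradient flow of the energy ℰ(ρ) = ∫ ρ·Φ. -/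
open MeasureTheory

section HomotopyWeight

variable {α : Type*} [MeasurableSpace α] {μ : Measure α} {f Φ : α → ℝ}

lemma mul_exp_neg_mul_le_inv {t x : ℝ} (ht : 0 < t) : x * Real.exp (-(t * x)) ≤ t⁻¹ := by
  have hle : t * x ≤ Real.exp (t * x) := by linarith [Real.add_one_le_exp (t * x)]
  rw [Real.exp_neg, ← div_eq_mul_inv, div_le_iff₀ (Real.exp_pos _), inv_mul_eq_div,
    le_div_iff₀ ht]
  linarith

lemma exp_neg_mul_mul_le {t x y : ℝ} (ht : 0 ≤ t) (hx : 0 ≤ x) (hy : 0 ≤ y) :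
    Real.exp (-(t * x)) * y ≤ y :=
  mul_le_of_le_one_left hy (Real.exp_le_one_iff.2 (neg_nonpos.2 (mul_nonneg ht hx)))

lemma hasDerivAt_exp_neg_mul_mul (t x y : ℝ) :
    HasDerivAt (fun s => Real.exp (-(s * x)) * y) (-(x * (Real.exp (-(t * x)) * y))) t := by
  have h : HasDerivAt (fun s => -(s * x)) (-(1 * x)) t := ((hasDerivAt_id t).mul_const x).neg
  exact (h.exp.mul_const y).congr_deriv (by ring)

lemma integrable_exp_neg_mul_mul (hf : Integrable f μ) (hf0 : ∀ a, 0 ≤ f a)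
    (hΦ : Measurable Φ) (hΦ0 : ∀ a, 0 ≤ Φ a) {t : ℝ} (ht : 0 ≤ t) :
    Integrable (fun a => Real.exp (-(t * Φ a)) * f a) μ := by
  refine hf.mono ((by fun_prop : Measurable fun a => Real.exp (-(t * Φ a))).aestronglyMeasurable.mul
    hf.aestronglyMeasurable) (.of_forall fun a => ?_)
  rw [Real.norm_of_nonneg (mul_nonneg (Real.exp_pos _).le (hf0 a)), Real.norm_of_nonneg (hf0 a)]
  exact exp_neg_mul_mul_le ht (hΦ0 a) (hf0 a)

lemma integral_exp_neg_mul_mul_pos (hf : Integrable f μ) (hf0 : ∀ a, 0 ≤ f a)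
    (hpos : 0 < ∫ a, f a ∂μ) (hΦ : Measurable Φ) (hΦ0 : ∀ a, 0 ≤ Φ a) {t : ℝ} (ht : 0 ≤ t) :
    0 < ∫ a, Real.exp (-(t * Φ a)) * f a ∂μ := by
  rw [integral_pos_iff_support_of_nonneg hf0 hf] at hpos
  rw [integral_pos_iff_support_of_nonneg (fun a => mul_nonneg (Real.exp_pos _).le (hf0 a))
    (integrable_exp_neg_mul_mul hf hf0 hΦ hΦ0 ht)]
  convert hpos using 2
  ext a
  simp [(Real.exp_pos _).ne']

/-- Differentiation under the integral sign for `t ↦ ∫ e^{-tΦ} f`, at positive times. -/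
lemma hasDerivAt_integral_exp_neg_mul_mul (hf : Integrable f μ) (hf0 : ∀ a, 0 ≤ f a)
    (hΦ : Measurable Φ) (hΦ0 : ∀ a, 0 ≤ Φ a) {t : ℝ} (ht : 0 < t) :
    Integrable (fun a => -(Φ a * (Real.exp (-(t * Φ a)) * f a))) μ ∧
      HasDerivAt (fun s => ∫ a, Real.exp (-(s * Φ a)) * f a ∂μ)
        (∫ a, -(Φ a * (Real.exp (-(t * Φ a)) * f a)) ∂μ) t := by
  have hexp (s : ℝ) : AEStronglyMeasurable (fun a => Real.exp (-(s * Φ a)) * f a) μ :=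
    (by fun_prop : Measurable fun a => Real.exp (-(s * Φ a))).aestronglyMeasurable.mul
      hf.aestronglyMeasurable
  refine hasDerivAt_integral_of_dominated_loc_of_deriv_le
    (F' := fun s a => -(Φ a * (Real.exp (-(s * Φ a)) * f a)))
    (bound := fun a => (t / 2)⁻¹ * f a) (Ioi_mem_nhds (half_lt_self ht)) (.of_forall hexp)
    (integrable_exp_neg_mul_mul hf hf0 hΦ hΦ0 ht.le)
    (hΦ.aestronglyMeasurable.mul (hexp t)).neg (.of_forall fun a s hs => ?_)
    (hf.const_mul _) (.of_forall fun a s _ => ?_)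
  · have hs0 : 0 < s := (half_pos ht).trans hs
    rw [norm_neg, Real.norm_of_nonneg
      (mul_nonneg (hΦ0 a) (mul_nonneg (Real.exp_pos _).le (hf0 a))), ← mul_assoc]
    exact mul_le_mul_of_nonneg_right ((mul_exp_neg_mul_le_inv hs0).trans
      (inv_anti₀ (half_pos ht) (le_of_lt hs))) (hf0 a)
  · exact hasDerivAt_exp_neg_mul_mul s (Φ a) (f a)

end HomotopyWeight

/-- The homotopy density `ρ_t = e^{−tΦ}ρ₀ / 𝔼_{ρ₀}[e^{−tΦ}]` is well defined, is a probability
density, and solves the Fisher–Rao gradient flow of the energy `ℰ(ρ) = ∫ ρ·Φ`. -/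
theorem homotopy_solves_fisherRao {d : ℕ}
    (ρ₀ : (Fin d → ℝ) → ℝ) (Φ : (Fin d → ℝ) → ℝ)
    (hρ₀m : Measurable ρ₀) (hρ₀nn : ∀ θ, 0 ≤ ρ₀ θ) (hρ₀int : (∫ θ, ρ₀ θ) = 1)
    (hΦm : Measurable Φ) (hΦnn : ∀ θ, 0 ≤ Φ θ)
    (N : ℝ → ℝ) (hN : ∀ t, N t = ∫ θ, Real.exp (-(t * Φ θ)) * ρ₀ θ)
    (ρ : ℝ → (Fin d → ℝ) → ℝ)
    (hρ : ∀ t θ, ρ t θ = Real.exp (-(t * Φ θ)) * ρ₀ θ / N t) :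
    ∀ t : ℝ, 0 < t →
      -- (i) normalization and density property
      (0 < N t ∧ N t ≤ 1 ∧ (∀ θ, 0 ≤ ρ t θ) ∧ (∫ θ, ρ t θ) = 1) ∧
      -- (ii) integrability
      Integrable (fun θ => Φ θ * ρ t θ) ∧
      -- (iii) the Fisher–Rao gradient flow of ℰ(ρ) = ∫ ρ Φ
      (∀ θ, HasDerivAt (fun s => ρ s θ)
        (-(ρ t θ * (Φ θ - ∫ θ', Φ θ' * ρ t θ'))) t) := by
  intro t ht
  have hf : Integrable ρ₀ := .of_integral_ne_zero (by simp [hρ₀int])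
  have hNpos : 0 < N t := hN t ▸ integral_exp_neg_mul_mul_pos hf hρ₀nn
    (by simp [hρ₀int]) hΦm hΦnn ht.le
  obtain ⟨hint, hderiv⟩ := hasDerivAt_integral_exp_neg_mul_mul hf hρ₀nn hΦm hΦnn ht
  have hmean : (fun θ => Φ θ * ρ t θ) =
      fun θ => Φ θ * (Real.exp (-(t * Φ θ)) * ρ₀ θ) / N t := by
    funext θ
    rw [hρ, ← mul_div_assoc]
  refine ⟨⟨hNpos, ?_, fun θ => ?_, ?_⟩, ?_, fun θ => ?_⟩
  · rw [hN, ← hρ₀int]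
    exact integral_mono (integrable_exp_neg_mul_mul hf hρ₀nn hΦm hΦnn ht.le) hf
      fun θ => exp_neg_mul_mul_le ht.le (hΦnn θ) (hρ₀nn θ)
  · rw [hρ]
    exact div_nonneg (mul_nonneg (Real.exp_pos _).le (hρ₀nn θ)) hNpos.le
  · simp_rw [hρ t]
    rw [integral_div, ← hN, div_self hNpos.ne']
  · rw [hmean]
    exact (by simpa using hint.neg : Integrable fun θ =>
      Φ θ * (Real.exp (-(t * Φ θ)) * ρ₀ θ)).div_const _
  · rw [← funext hN, integral_neg] at hderiv
    rw [hmean, integral_div, hρ]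
    simp_rw [hρ]
    refine ((hasDerivAt_exp_neg_mul_mul t (Φ θ) (ρ₀ θ)).div hderiv hNpos.ne').congr_deriv ?_
    field_simp
    ring
end

section
/- Let Φ_R : ℝ^d → ℝ be twice continuously differentiable with Hessian satisfying Hess Φ_R(θ) ⪰ α·I for all θ, for some α > 0, and suppose ρ_post := e^{−Φ_R} is a probability density. Let λ > 0 and let P : [0,∞) × ℝ^d → ℝ^{d×d} take symmetric values with P_t(θ) ⪰ λ·I for all t, θ. Let ρ : [0,∞) × ℝ^d → (0,∞) be such that ρ_t := ρ(t,·) is a continuously differentiable probability density for every t, and suppose F(t) := ∫ ρ_t(θ)·log(ρ_t(θ)/ρ_post(θ)) dθ is finite and differentiable with F'(t) = −∫ ρ_t(θ)·(∇log ρ_t(θ) − ∇log ρ_post(θ))ᵀ · P_t(θ) · (∇log ρ_t(θ) − ∇log ρ_post(θ)) dθ for all t ≥ 0 (the dissipation identity satisfied by sufficiently regular solutions of the preconditioned Wasserstein gradient flow ∂_t ρ_t = ∇·(ρ_t P_t ∇log(ρ_t/ρ_post))). Then for all t ≥ 0, (1/2)·(∫ |ρ_t(θ) − ρ_post(θ)|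 dθ)² ≤ F(0)·e^{−2αλt}. -/
open MeasureTheory

section

open scoped ENNReal Pointwise

/-- The Prékopa–Leindler inequality holds on the measure space `E`. -/
def PrekopaLeindler (E : Type*) [AddCommGroup E] [Module ℝ E] [MeasureSpace E] : Prop :=
  ∀ t s : ℝ, 0 < t → 0 < s → t + s = 1 → ∀ f g h : E → ℝ≥0∞,
    Measurable f → Measurable g → Measurable h →
    (∀ x y, f x ^ t * g y ^ s ≤ h (t • x + s • y)) →
    (∫⁻ x, f x) ^ t * (∫⁻ x, g x) ^ s ≤ ∫⁻ x, h x

theorem volume_add_le_of_isCompact {K L C : Set ℝ} (hK : IsCompact K) (hL : IsCompact L)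
    (hKne : K.Nonempty) (hLne : L.Nonempty) (h : ∀ a ∈ K, ∀ b ∈ L, a + b ∈ C) :
    volume K + volume L ≤ volume C := by
  obtain ⟨a, ha⟩ := hK.exists_isGreatest hKne
  obtain ⟨b, hb⟩ := hL.exists_isLeast hLne
  have hLm : MeasurableSet ((fun x => a + x) '' L) :=
    (hL.image (continuous_const.add continuous_id)).measurableSet
  have hd : AEDisjoint volume ((fun x => x + b) '' K) ((fun x => a + x) '' L) := by
    refine measure_mono_null (t := {a + b}) ?_ (by simp)
    rintro _ ⟨⟨x, hx, rfl⟩, ⟨y, hy, hxy⟩⟩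
    have h1 := ha.2 hx
    have h2 := hb.2 hy
    simp only [Set.mem_singleton_iff] at *
    linarith
  calc volume K + volume L
      = volume ((fun x => x + b) '' K) + volume ((fun x => a + x) '' L) := by
        simp [Set.image_add_right, Set.image_add_left, measure_preimage_add,
          measure_preimage_add_right]
    _ = volume ((fun x => x + b) '' K ∪ (fun x => a + x) '' L) :=
        (measure_union₀ hLm.nullMeasurableSet hd).symm
    _ ≤ volume C := by
        apply measure_mono
        rintro _ (⟨x, hx, rfl⟩ | ⟨y, hy, rfl⟩)
        · exact h x hx b hb.1
        · exact h a ha.1 y hy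

/-- The one-dimensional Brunn–Minkowski inequality. -/
theorem volume_add_le_of_add_mem {A B C : Set ℝ} (hA : MeasurableSet A) (hB : MeasurableSet B)
    (hAne : A.Nonempty) (hBne : B.Nonempty) (h : ∀ a ∈ A, ∀ b ∈ B, a + b ∈ C) :
    volume A + volume B ≤ volume C := by
  obtain ⟨a, ha⟩ := hAne
  obtain ⟨b, hb⟩ := hBne
  rw [hA.measure_eq_iSup_isCompact, hB.measure_eq_iSup_isCompact]
  simp only [iSup_and']
  refine ENNReal.biSup_add_biSup_le' ⟨∅, by simp⟩ ⟨∅, by simp⟩ ?_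
  rintro K ⟨hKA, hK⟩ L ⟨hLB, hL⟩
  calc volume K + volume L ≤ volume (insert a K) + volume (insert b L) := by
        gcongr <;> exact Set.subset_insert _ _
    _ ≤ volume C := by
        refine volume_add_le_of_isCompact (hK.insert a) (hL.insert b) (Set.insert_nonempty _ _)
          (Set.insert_nonempty _ _) fun x hx y hy => h x ?_ y ?_
        · exact Set.insert_subset ha hKA hx
        · exact Set.insert_subset hb hLB hy

theorem volume_smul_add_le_of_mem {A B C : Set ℝ} (hA : MeasurableSet A) (hB : MeasurableSet B)
    (hAne : A.Nonempty) (hBne : B.Nonempty) {t s : ℝ} (ht : 0 < t) (hs : 0 < s)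
    (h : ∀ a ∈ A, ∀ b ∈ B, t * a + s * b ∈ C) :
    ENNReal.ofReal t * volume A + ENNReal.ofReal s * volume B ≤ volume C := by
  have e : ∀ (r : ℝ) (S : Set ℝ), 0 < r → ENNReal.ofReal r * volume S = volume (r • S) := by
    intro r S hr
    simp [Measure.addHaar_smul, abs_of_pos hr]
  rw [e t A ht, e s B hs]
  refine volume_add_le_of_add_mem (hA.const_smul_of_ne_zero ht.ne')
    (hB.const_smul_of_ne_zero hs.ne') hAne.smul_set hBne.smul_set ?_
  rintro _ ⟨x, hx, rfl⟩ _ ⟨y, hy, rfl⟩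
  exact h x hx y hy

theorem lintegral_eq_lintegral_volume_lt {f : ℝ → ℝ≥0∞} (hf : Measurable f) (hf1 : ∀ x, f x ≤ 1) :
    ∫⁻ x, f x = ∫⁻ l in Set.Ioi (0 : ℝ), volume {x | ENNReal.ofReal l < f x} := by
  have hfin : ∀ x, f x ≠ ∞ := fun x => ((hf1 x).trans_lt ENNReal.one_lt_top).ne
  have := lintegral_eq_lintegral_meas_lt (f := fun x => (f x).toReal) volume
    (Filter.Eventually.of_forall fun _ => ENNReal.toReal_nonneg) hf.ennreal_toReal.aemeasurable
  simp only [ENNReal.ofReal_toReal (hfin _)] at this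
  rw [this]
  refine setLIntegral_congr_fun measurableSet_Ioi fun l hl => ?_
  congr 1
  ext x
  simp only [Set.mem_ofPred_eq]
  rw [ENNReal.ofReal_lt_iff_lt_toReal (le_of_lt hl) (hfin x)]

theorem add_lintegral_le_of_iSup_eq_one {t s : ℝ} (ht : 0 < t) (hs : 0 < s) (hts : t + s = 1)
    {f g h : ℝ → ℝ≥0∞} (hf : Measurable f) (hg : Measurable g) (hh : Measurable h)
    (hfgh : ∀ x y, f x ^ t * g y ^ s ≤ h (t * x + s * y))
    (hf1 : ⨆ x, f x = 1) (hg1 : ⨆ x, g x = 1) :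
    ENNReal.ofReal t * (∫⁻ x, f x) + ENNReal.ofReal s * (∫⁻ x, g x) ≤ ∫⁻ x, h x := by
  have hf1' : ∀ x, f x ≤ 1 := fun x => hf1 ▸ le_iSup f x
  have hg1' : ∀ x, g x ≤ 1 := fun x => hg1 ▸ le_iSup g x
  have hmeas : ∀ k : ℝ → ℝ≥0∞, Measurable fun l : ℝ => volume {x | ENNReal.ofReal l < k x} :=
    fun k => Antitone.measurable fun a b hab => measure_mono fun x hx =>
      (ENNReal.ofReal_le_ofReal hab).trans_lt hx
  calc ENNReal.ofReal t * (∫⁻ x, f x) + ENNReal.ofReal s * (∫⁻ x, g x)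
      = ∫⁻ l in Set.Ioi (0 : ℝ), (ENNReal.ofReal t * volume {x | ENNReal.ofReal l < f x}
          + ENNReal.ofReal s * volume {x | ENNReal.ofReal l < g x}) := by
        rw [lintegral_eq_lintegral_volume_lt hf hf1', lintegral_eq_lintegral_volume_lt hg hg1',
          lintegral_add_left ((hmeas f).const_mul _), lintegral_const_mul _ (hmeas f),
          lintegral_const_mul _ (hmeas g)]
    _ ≤ ∫⁻ l in Set.Ioi (0 : ℝ), volume {x | ENNReal.ofReal l < min (h x) 1} := by
        refine setLIntegral_mono (hmeas _) fun l hl => ?_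
        rcases lt_or_ge l 1 with hl1 | hl1
        · have hl1' : ENNReal.ofReal l < 1 := by simpa using hl1
          refine volume_smul_add_le_of_mem (measurableSet_lt measurable_const hf)
            (measurableSet_lt measurable_const hg) ?_ ?_ ht hs ?_
          · exact lt_iSup_iff.1 (hf1 ▸ hl1')
          · exact lt_iSup_iff.1 (hg1 ▸ hl1')
          · intro a ha b hb
            refine lt_min ((lt_of_lt_of_le ?_ (hfgh a b))) hl1'
            calc ENNReal.ofReal l = ENNReal.ofReal l ^ t * ENNReal.ofReal l ^ s := by
                  rw [← ENNReal.rpow_add _ _ (by simpa using hl) (by simp), hts, ENNReal.rpow_one]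
              _ < f a ^ t * g b ^ s :=
                  ENNReal.mul_lt_mul (ENNReal.rpow_lt_rpow ha ht) (ENNReal.rpow_lt_rpow hb hs)
        · have h1 : ∀ k : ℝ → ℝ≥0∞, (∀ x, k x ≤ 1) → {x | ENNReal.ofReal l < k x} = ∅ := by
            intro k hk
            ext x
            simpa using (hk x).trans (by simpa using hl1)
          rw [h1 f hf1', h1 g hg1']
          simp
    _ = ∫⁻ x, min (h x) 1 :=
        (lintegral_eq_lintegral_volume_lt (hh.min measurable_const) fun x => min_le_right _ _).symm
    _ ≤ ∫⁻ x, h x := lintegral_mono fun x => min_le_left _ _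

theorem ENNReal.rpow_mul_rpow_le_add {t s : ℝ} (ht : 0 < t) (hs : 0 < s) (hts : t + s = 1)
    (a b : ℝ≥0∞) : a ^ t * b ^ s ≤ ENNReal.ofReal t * a + ENNReal.ofReal s * b := by
  have hpq : (1 / t).HolderConjugate (1 / s) := by
    rw [Real.holderConjugate_iff]
    refine ⟨?_, by simpa using hts⟩
    rw [lt_div_iff₀ ht]
    linarith
  have := ENNReal.young_inequality (a ^ t) (b ^ s) hpq
  rw [← ENNReal.rpow_mul, ← ENNReal.rpow_mul, mul_one_div_cancel ht.ne',
    mul_one_div_cancel hs.ne', ENNReal.rpow_one, ENNReal.rpow_one] at this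
  rw [one_div, one_div, ENNReal.ofReal_inv_of_pos ht, ENNReal.ofReal_inv_of_pos hs,
    div_eq_mul_inv, div_eq_mul_inv, inv_inv, inv_inv] at this
  rwa [mul_comm (ENNReal.ofReal t), mul_comm (ENNReal.ofReal s)]

theorem lintegral_rpow_mul_le_of_bounded {t s : ℝ} (ht : 0 < t) (hs : 0 < s) (hts : t + s = 1)
    {f g h : ℝ → ℝ≥0∞} (hf : Measurable f) (hg : Measurable g) (hh : Measurable h)
    (hfgh : ∀ x y, f x ^ t * g y ^ s ≤ h (t * x + s * y))
    (hfb : ⨆ x, f x ≠ ∞) (hgb : ⨆ x, g x ≠ ∞) :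
    (∫⁻ x, f x) ^ t * (∫⁻ x, g x) ^ s ≤ ∫⁻ x, h x := by
  set a := ⨆ x, f x with ha
  set b := ⨆ x, g x with hb
  by_cases ha0 : a = 0
  · have : ∀ x, f x = 0 := fun x => le_antisymm (ha0 ▸ le_iSup f x) zero_le
    simp [this, ht]
  by_cases hb0 : b = 0
  · have : ∀ x, g x = 0 := fun x => le_antisymm (hb0 ▸ le_iSup g x) zero_le
    simp [this, hs]
  have hc0 : a ^ t * b ^ s ≠ 0 :=
    mul_ne_zero (by simp [ha0, hfb, ht]) (by simp [hb0, hgb, hs])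
  have hct : a ^ t * b ^ s ≠ ∞ := ENNReal.mul_ne_top (by simp [ha0, hfb])
    (by simp [hb0, hgb])
  have key := add_lintegral_le_of_iSup_eq_one ht hs hts (hf.const_mul a⁻¹) (hg.const_mul b⁻¹)
    (hh.const_mul (a ^ t * b ^ s)⁻¹) (fun x y => by
      rw [ENNReal.mul_rpow_of_nonneg _ _ ht.le, ENNReal.mul_rpow_of_nonneg _ _ hs.le,
        ENNReal.mul_inv (Or.inr (by simp [hb0, hgb])) (Or.inr (by simp [hb0, hgb, hs])),
        ENNReal.inv_rpow, ENNReal.inv_rpow, mul_mul_mul_comm]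
      gcongr
      exact hfgh x y)
    (by rw [← ENNReal.mul_iSup, ← ha, ENNReal.inv_mul_cancel ha0 hfb])
    (by rw [← ENNReal.mul_iSup, ← hb, ENNReal.inv_mul_cancel hb0 hgb])
  have key := (ENNReal.rpow_mul_rpow_le_add ht hs hts _ _).trans key
  rw [lintegral_const_mul _ hf, lintegral_const_mul _ hg, lintegral_const_mul _ hh,
    ENNReal.mul_rpow_of_nonneg _ _ ht.le, ENNReal.mul_rpow_of_nonneg _ _ hs.le,
    mul_mul_mul_comm, ENNReal.inv_rpow, ENNReal.inv_rpow,
    ← ENNReal.mul_inv (Or.inr (by simp [hb0, hgb])) (Or.inr (by simp [hb0, hgb, hs]))] at key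
  exact (ENNReal.mul_le_mul_iff_right (ENNReal.inv_ne_zero.2 hct) (ENNReal.inv_ne_top.2 hc0)).1 key

theorem lintegral_min_natCast_tendsto {f : ℝ → ℝ≥0∞} (hf : Measurable f) :
    Filter.Tendsto (fun n : ℕ => ∫⁻ x, min (f x) n) Filter.atTop (nhds (∫⁻ x, f x)) := by
  refine lintegral_tendsto_of_tendsto_of_monotone
    (fun n => (hf.min measurable_const).aemeasurable) ?_ ?_
  · refine Filter.Eventually.of_forall fun x m n hmn => ?_
    dsimp only
    gcongr
  · refine Filter.Eventually.of_forall fun x => ?_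
    have : Filter.Tendsto (fun n : ℕ => min (f x) (n : ℝ≥0∞)) Filter.atTop (nhds (min (f x) ∞)) :=
      tendsto_const_nhds.min ENNReal.tendsto_nat_nhds_top
    simpa using this

theorem prekopaLeindler_real : PrekopaLeindler ℝ := by
  intro t s ht hs hts f g h hf hg hh hfgh
  by_cases hf0 : ∫⁻ x, f x = 0
  · simp [hf0, ht]
  by_cases hg0 : ∫⁻ x, g x = 0
  · simp [hg0, hs]
  refine le_of_tendsto (ENNReal.Tendsto.mul
    ((ENNReal.continuous_rpow_const (y := t)).continuousAt.tendsto.comp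
      (lintegral_min_natCast_tendsto hf)) (Or.inl ?_)
    ((ENNReal.continuous_rpow_const (y := s)).continuousAt.tendsto.comp
      (lintegral_min_natCast_tendsto hg)) (Or.inl ?_))
    (Filter.Eventually.of_forall fun n => ?_)
  · simp [hf0, ht.not_gt]
  · simp [hg0, hs.not_gt]
  · refine lintegral_rpow_mul_le_of_bounded ht hs hts (hf.min measurable_const)
      (hg.min measurable_const) hh (fun x y => le_trans ?_ (hfgh x y)) ?_ ?_
    · gcongr <;> exact min_le_left _ _
    · exact ((iSup_le fun x => min_le_right _ _).trans_lt (ENNReal.natCast_lt_top n)).ne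
    · exact ((iSup_le fun x => min_le_right _ _).trans_lt (ENNReal.natCast_lt_top n)).ne

theorem PrekopaLeindler.prod {E F : Type*} [AddCommGroup E] [Module ℝ E] [MeasureSpace E]
    [AddCommGroup F] [Module ℝ F] [MeasureSpace F] [SFinite (volume : Measure F)]
    (hE : PrekopaLeindler E) (hF : PrekopaLeindler F) : PrekopaLeindler (E × F) := by
  intro t s ht hs hts f g h hf hg hh hfgh
  rw [Measure.volume_eq_prod, lintegral_prod _ hf.aemeasurable, lintegral_prod _ hg.aemeasurable,
    lintegral_prod _ hh.aemeasurable]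
  refine hE t s ht hs hts _ _ _ hf.lintegral_prod_right' hg.lintegral_prod_right'
    hh.lintegral_prod_right' fun x y => ?_
  exact hF t s ht hs hts _ _ _ (hf.comp measurable_prodMk_left) (hg.comp measurable_prodMk_left)
    (hh.comp measurable_prodMk_left) fun x' y' => hfgh (x, x') (y, y')

theorem PrekopaLeindler.of_measurePreserving {E F : Type*} [AddCommGroup E] [Module ℝ E]
    [MeasureSpace E] [AddCommGroup F] [Module ℝ F] [MeasureSpace F] (hE : PrekopaLeindler E)
    (e : E →ₗ[ℝ] F) (he : MeasurePreserving e volume volume) : PrekopaLeindler F := by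
  intro t s ht hs hts f g h hf hg hh hfgh
  rw [← he.lintegral_comp hf, ← he.lintegral_comp hg, ← he.lintegral_comp hh]
  refine hE t s ht hs hts _ _ _ (hf.comp he.measurable) (hg.comp he.measurable)
    (hh.comp he.measurable) fun x y => ?_
  simpa using hfgh (e x) (e y)

theorem prekopaLeindler_pi (n : ℕ) : PrekopaLeindler (Fin n → ℝ) := by
  induction n with
  | zero =>
    intro t s ht hs hts f g h hf hg hh hfgh
    have hx : ∀ x : Fin 0 → ℝ, x = default := fun x => Subsingleton.elim _ _
    have := hfgh default default
    rw [hx (t • default + s • default)] at this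
    simpa [Measure.volume_pi_eq_dirac (default : Fin 0 → ℝ)] using this
  | succ n ih =>
    refine (prekopaLeindler_real.prod ih).of_measurePreserving
      (Fin.consLinearEquiv ℝ (fun _ : Fin (n + 1) => ℝ)).toLinearMap ?_
    have h : ⇑(Fin.consLinearEquiv ℝ (fun _ : Fin (n + 1) => ℝ)).toLinearMap =
        (MeasurableEquiv.piFinSuccAbove (fun _ : Fin (n + 1) => ℝ) 0).symm := by
      funext p
      simp only [LinearEquiv.coe_coe, MeasurableEquiv.piFinSuccAbove, Fin.insertNthEquiv_zero]
      rfl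
    rw [h]
    exact (volume_preserving_piFinSuccAbove (fun _ : Fin (n + 1) => ℝ) 0).symm

/-- The **Prékopa–Leindler inequality** on Euclidean space. -/
theorem prekopaLeindler_euclideanSpace (n : ℕ) : PrekopaLeindler (EuclideanSpace ℝ (Fin n)) :=
  (prekopaLeindler_pi n).of_measurePreserving
    (WithLp.linearEquiv 2 ℝ (Fin n → ℝ)).symm.toLinearMap (PiLp.volume_preserving_toLp _)

theorem add_mul_sq_le_of_hessian {E : Type*} [NormedAddCommGroup E] [NormedSpace ℝ E]
    {Φ : E → ℝ} (hΦ : ContDiff ℝ 2 Φ) {α : ℝ}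
    (hconv : ∀ x v : E, α * ‖v‖ ^ 2 ≤ iteratedFDeriv ℝ 2 Φ x ![v, v]) {t s : ℝ}
    (ht : 0 < t) (hs : 0 < s) (hts : t + s = 1) (x y : E) :
    Φ (t • x + s • y) + α / 2 * (t * s * ‖x - y‖ ^ 2) ≤ t * Φ x + s * Φ y := by
  set v := x - y with hv
  have hΦ1 : Differentiable ℝ Φ := hΦ.differentiable (by norm_num)
  have hΦ2 : Differentiable ℝ (fderiv ℝ Φ) :=
    (hΦ.fderiv_right (m := 1) (by norm_num)).differentiable (by norm_num)
  have hline : ∀ r : ℝ, HasDerivAt (fun r : ℝ => y + r • v) v r := fun r => by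
    simpa using ((hasDerivAt_id r).smul_const v).const_add y
  have hd1 : ∀ r : ℝ, HasDerivAt (fun r : ℝ => Φ (y + r • v) - α / 2 * ‖v‖ ^ 2 * r ^ 2)
      (fderiv ℝ Φ (y + r • v) v - α * ‖v‖ ^ 2 * r) r := fun r => by
    have h1 := (hΦ1 (y + r • v)).hasFDerivAt.comp_hasDerivAt r (hline r)
    have h2 := ((hasDerivAt_id r).pow 2).const_mul (α / 2 * ‖v‖ ^ 2)
    refine (h1.sub h2).congr_deriv ?_
    simp
    ring
  have hd2 : ∀ r : ℝ, HasDerivAt (fun r : ℝ => fderiv ℝ Φ (y + r • v) v - α * ‖v‖ ^ 2 * r)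
      (iteratedFDeriv ℝ 2 Φ (y + r • v) ![v, v] - α * ‖v‖ ^ 2) r := fun r => by
    have h1 := (hΦ2 (y + r • v)).hasFDerivAt.comp_hasDerivAt r (hline r)
    have h2 := h1.clm_apply (hasDerivAt_const r v)
    have h3 := (hasDerivAt_id r).const_mul (α * ‖v‖ ^ 2)
    refine (h2.sub h3).congr_deriv ?_
    simp [iteratedFDeriv_two_apply]
  have e1 : deriv (fun r : ℝ => Φ (y + r • v) - α / 2 * ‖v‖ ^ 2 * r ^ 2) =
      fun r => fderiv ℝ Φ (y + r • v) v - α * ‖v‖ ^ 2 * r := funext fun r => (hd1 r).deriv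
  have hc : ConvexOn ℝ Set.univ (fun r : ℝ => Φ (y + r • v) - α / 2 * ‖v‖ ^ 2 * r ^ 2) := by
    refine convexOn_univ_of_deriv2_nonneg (fun r => (hd1 r).differentiableAt) ?_ ?_
    · rw [e1]
      exact fun r => (hd2 r).differentiableAt
    · intro r
      simp only [Function.iterate_succ, Function.iterate_zero, Function.comp, id]
      rw [e1, (hd2 r).deriv]
      linarith [hconv (y + r • v) v]
  have h := hc.2 (Set.mem_univ 1) (Set.mem_univ 0) ht.le hs.le hts
  have ex : y + (1 : ℝ) • v = x := by rw [hv]; module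
  have ez : y + (t • (1 : ℝ) + s • (0 : ℝ)) • v = t • x + s • y := by
    have : s = 1 - t := by linarith
    rw [hv, this]
    simp only [smul_eq_mul]
    module
  beta_reduce at h
  rw [ez, ex] at h
  simp only [smul_eq_mul, zero_smul, add_zero] at h
  have : s = 1 - t := by linarith
  subst this
  nlinarith [h]

/-- The integrated form, for a measure `μ`, of the Prékopa–Leindler inequality relative to an
`α`-strongly logconcave density. -/
def HopfLaxInequality {E : Type*} [NormedAddCommGroup E] [MeasurableSpace E] (α : ℝ)
    (μ : Measure E) : Prop :=
  ∀ t s : ℝ, 0 < t → 0 < s → t + s = 1 → ∀ g G : E → ℝ, Continuous g → Continuous G →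
    (∃ M, ∀ x, |g x| ≤ M) → (∃ M, ∀ x, |G x| ≤ M) →
    (∀ x z, g x - α * t / (2 * s) * ‖x - z‖ ^ 2 ≤ G z) →
    (∫ x, Real.exp (g x / t) ∂μ) ^ t ≤ ∫ x, Real.exp (G x) ∂μ

theorem integrable_of_continuous_of_bounded {E : Type*} [TopologicalSpace E] [MeasurableSpace E]
    [OpensMeasurableSpace E] {μ : Measure E} [IsFiniteMeasure μ] {f : E → ℝ} (hf : Continuous f)
    {M : ℝ} (hM : ∀ x, |f x| ≤ M) : Integrable f μ :=
  Integrable.of_bound hf.measurable.aestronglyMeasurable M (Filter.Eventually.of_forall hM)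

theorem integrable_exp_of_bounded {E : Type*} [TopologicalSpace E] [MeasurableSpace E]
    [OpensMeasurableSpace E] {μ : Measure E} [IsFiniteMeasure μ] {f : E → ℝ} (hf : Continuous f)
    {M : ℝ} (hM : ∀ x, f x ≤ M) : Integrable (fun x => Real.exp (f x)) μ :=
  integrable_of_continuous_of_bounded (M := Real.exp M) (by fun_prop) fun x => by
    rw [Real.abs_exp]
    exact Real.exp_le_exp.2 (hM x)

theorem lintegral_ofReal_exp_withDensity {E : Type*} [TopologicalSpace E] [MeasurableSpace E]
    [OpensMeasurableSpace E] {ν : Measure E} {Φ f : E → ℝ} (hΦ : Continuous Φ)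
    (hf : Continuous f) :
    ∫⁻ x, ENNReal.ofReal (Real.exp (f x))
        ∂ν.withDensity (fun x => ENNReal.ofReal (Real.exp (-Φ x))) =
      ∫⁻ x, ENNReal.ofReal (Real.exp (f x - Φ x)) ∂ν := by
  rw [lintegral_withDensity_eq_lintegral_mul _ (by fun_prop) (by fun_prop)]
  refine lintegral_congr fun x => ?_
  simp only [Pi.mul_apply]
  rw [← ENNReal.ofReal_mul (Real.exp_pos _).le, ← Real.exp_add]
  ring_nf

theorem PrekopaLeindler.hopfLaxInequality {E : Type*} [NormedAddCommGroup E] [NormedSpace ℝ E]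
    [MeasureSpace E] [BorelSpace E] (hE : PrekopaLeindler E) {Φ : E → ℝ} (hΦ : ContDiff ℝ 2 Φ)
    {α : ℝ} (hα : 0 < α) (hconv : ∀ x v : E, α * ‖v‖ ^ 2 ≤ iteratedFDeriv ℝ 2 Φ x ![v, v])
    [IsProbabilityMeasure (volume.withDensity fun x => ENNReal.ofReal (Real.exp (-Φ x)))] :
    HopfLaxInequality α (volume.withDensity fun x => ENNReal.ofReal (Real.exp (-Φ x))) := by
  intro t s ht hs hts g G hg hG ⟨M, hM⟩ ⟨M', hM'⟩ hgG
  set μ := (volume : Measure E).withDensity fun x => ENNReal.ofReal (Real.exp (-Φ x)) with hμ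
  have hΦc : Continuous Φ := hΦ.continuous
  have key := hE t s ht hs hts (fun x => ENNReal.ofReal (Real.exp (g x / t - Φ x)))
    (fun x => ENNReal.ofReal (Real.exp (0 - Φ x)))
    (fun x => ENNReal.ofReal (Real.exp (G x - Φ x)))
    (by fun_prop) (by fun_prop) (by fun_prop) (fun x y => by
      rw [ENNReal.ofReal_rpow_of_pos (Real.exp_pos _), ENNReal.ofReal_rpow_of_pos (Real.exp_pos _),
        ← ENNReal.ofReal_mul (by positivity), ← Real.exp_mul, ← Real.exp_mul, ← Real.exp_add]
      refine ENNReal.ofReal_le_ofReal (Real.exp_le_exp.2 ?_)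
      have h1 := add_mul_sq_le_of_hessian hΦ hconv ht hs hts x y
      have h2 := hgG x (t • x + s • y)
      have h3 : x - (t • x + s • y) = s • (x - y) := by
        have : t = 1 - s := by linarith
        rw [this]
        module
      rw [h3, norm_smul, Real.norm_of_nonneg hs.le, mul_pow] at h2
      have h4 : α * t / (2 * s) * (s ^ 2 * ‖x - y‖ ^ 2) = α / 2 * (t * s * ‖x - y‖ ^ 2) := by
        field_simp
      rw [h4] at h2
      have h5 : (g x / t - Φ x) * t = g x - t * Φ x := by field_simp
      rw [h5]
      linarith)
  rw [← lintegral_ofReal_exp_withDensity hΦc (by fun_prop),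
    ← lintegral_ofReal_exp_withDensity hΦc (by fun_prop),
    ← lintegral_ofReal_exp_withDensity hΦc (by fun_prop), ← hμ] at key
  have hi1 : Integrable (fun x => Real.exp (g x / t)) μ :=
    integrable_exp_of_bounded (M := M / t) (by fun_prop)
      fun x => div_le_div_of_nonneg_right ((le_abs_self _).trans (hM x)) ht.le
  have hi2 : Integrable (fun x => Real.exp (G x)) μ :=
    integrable_exp_of_bounded hG fun x => (le_abs_self _).trans (hM' x)
  rw [← ofReal_integral_eq_lintegral_ofReal hi1 (Filter.Eventually.of_forall fun _ => by positivity),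
    ← ofReal_integral_eq_lintegral_ofReal hi2 (Filter.Eventually.of_forall fun _ => by positivity)]
    at key
  simp only [Real.exp_zero, ENNReal.ofReal_one, lintegral_const, measure_univ, mul_one,
    ENNReal.one_rpow] at key
  rw [ENNReal.ofReal_rpow_of_nonneg (by positivity) ht.le] at key
  exact (ENNReal.ofReal_le_ofReal_iff (by positivity)).1 key

theorem deriv_le_of_eventually_le_right {f g : ℝ → ℝ} {f' g' x : ℝ} (hf : HasDerivAt f f' x)
    (hg : HasDerivAt g g' x) (h0 : f x = g x)
    (h : ∀ᶠ r in nhdsWithin (0 : ℝ) (Set.Ioi 0), f (x + r) ≤ g (x + r)) : f' ≤ g' := by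
  refine le_of_tendsto_of_tendsto hf.tendsto_slope_zero_right hg.tendsto_slope_zero_right ?_
  filter_upwards [h, self_mem_nhdsWithin] with r hr hr0
  have : (0 : ℝ) < r := hr0
  rw [h0]
  simp only [smul_eq_mul]
  gcongr

theorem exists_sub_le_mul_norm_sub {E : Type*} [NormedAddCommGroup E] [NormedSpace ℝ E]
    {g : E → ℝ} (hg : Differentiable ℝ g) (hu : UniformContinuous (fderiv ℝ g)) {ε : ℝ}
    (hε : 0 < ε) :
    ∃ η > 0, ∀ x z, ‖x - z‖ < η → g x - g z ≤ (‖fderiv ℝ g z‖ + ε) * ‖x - z‖ := by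
  obtain ⟨η, hη, h⟩ := Metric.uniformContinuous_iff.1 hu ε hε
  refine ⟨η, hη, fun x z hxz => ?_⟩
  have := (convex_ball z η).norm_image_sub_le_of_norm_fderiv_le (𝕜 := ℝ) (f := g)
    (C := ‖fderiv ℝ g z‖ + ε) (x := z) (y := x) (fun w _ => hg w) (fun w hw => ?_)
    (Metric.mem_ball_self hη) (by simpa [dist_eq_norm] using hxz)
  · exact (le_abs_self _).trans this
  · have h1 := h (a := w) (b := z) hw
    rw [dist_eq_norm] at h1
    linarith [norm_le_norm_add_norm_sub' (fderiv ℝ g w) (fderiv ℝ g z)]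

theorem HopfLaxInequality.integral_exp_le {E : Type*} [NormedAddCommGroup E] [NormedSpace ℝ E]
    [MeasurableSpace E] {α : ℝ} (hα : 0 < α)
    {μ : Measure E} (hμ : HopfLaxInequality α μ) {g : E → ℝ}
    (hg : ContDiff ℝ 1 g) {M L : ℝ} (hM : ∀ x, |g x| ≤ M) (hL : ∀ x, ‖fderiv ℝ g x‖ ≤ L)
    (hu : UniformContinuous (fderiv ℝ g)) {ε : ℝ} (hε : 0 < ε) :
    ∀ᶠ r in nhdsWithin (0 : ℝ) (Set.Ioi 0),
      (∫ x, Real.exp ((1 + r) * g x) ∂μ) ^ (1 / (1 + r)) ≤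
        ∫ x, Real.exp (g x + r * ((‖fderiv ℝ g x‖ + ε) ^ 2 / (2 * α))) ∂μ := by
  obtain ⟨η, hη, h⟩ := exists_sub_le_mul_norm_sub (hg.differentiable (by norm_num)) hu hε
  have hDc : Continuous (fderiv ℝ g) := hg.continuous_fderiv (by norm_num)
  have hM0 : ∀ _ : E, 0 ≤ M := fun x => (abs_nonneg _).trans (hM x)
  have hr0 : ∀ᶠ r in nhdsWithin (0 : ℝ) (Set.Ioi 0), r * (4 * M) < α * η ^ 2 := by
    refine (Filter.Tendsto.eventually_lt_const (v := 0 * (4 * M)) (by simp; positivity) ?_)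
    exact (tendsto_nhdsWithin_of_tendsto_nhds Filter.tendsto_id).mul_const _
  filter_upwards [hr0, self_mem_nhdsWithin] with r hrM hr
  have hr : 0 < r := hr
  have := hμ (1 / (1 + r)) (r / (1 + r)) (by positivity) (by positivity) (by field_simp) g
    (fun x => g x + r * ((‖fderiv ℝ g x‖ + ε) ^ 2 / (2 * α))) hg.continuous
    (by have := hg.continuous; fun_prop) ⟨M, hM⟩
    ⟨M + r * ((L + ε) ^ 2 / (2 * α)), fun x => ?_⟩ fun x z => ?_
  · convert this using 5 with x
    field_simp
  · refine (abs_add_le _ _).trans (add_le_add (hM x) ?_)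
    rw [abs_of_nonneg (by positivity)]
    gcongr
    exact hL x
  · have e1 : α * (1 / (1 + r)) / (2 * (r / (1 + r))) = α / (2 * r) := by field_simp
    rw [e1]
    set a := ‖fderiv ℝ g z‖ + ε with ha
    have ha0 : 0 ≤ a := by positivity
    rcases lt_or_ge ‖x - z‖ η with hxz | hxz
    · have h1 := h x z hxz
      have h2 : 0 ≤ (α * ‖x - z‖ - r * a) ^ 2 / (2 * r * α) := by positivity
      have h3 : (α * ‖x - z‖ - r * a) ^ 2 / (2 * r * α) =
          α / (2 * r) * ‖x - z‖ ^ 2 - a * ‖x - z‖ + r * (a ^ 2 / (2 * α)) := by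
        field_simp
        ring
      linarith
    · have h1 : 2 * M ≤ α / (2 * r) * η ^ 2 := by
        rw [div_mul_eq_mul_div, le_div_iff₀ (by positivity)]
        linarith
      have h2 : α / (2 * r) * η ^ 2 ≤ α / (2 * r) * ‖x - z‖ ^ 2 := by gcongr
      have h3 : 0 ≤ r * (a ^ 2 / (2 * α)) := by positivity
      have h4 := abs_le.1 (hM x)
      have h5 := abs_le.1 (hM z)
      linarith

theorem HopfLaxInequality.logSobolev_add {E : Type*} [NormedAddCommGroup E] [NormedSpace ℝ E]
    [MeasurableSpace E] [BorelSpace E] {α : ℝ} (hα : 0 < α)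
    {μ : Measure E} [IsProbabilityMeasure μ] (hμ : HopfLaxInequality α μ) {g : E → ℝ}
    (hg : ContDiff ℝ 1 g) {M L : ℝ} (hM : ∀ x, |g x| ≤ M) (hL : ∀ x, ‖fderiv ℝ g x‖ ≤ L)
    (hu : UniformContinuous (fderiv ℝ g)) {ε : ℝ} (hε : 0 < ε) :
    ∫ x, g x * Real.exp (g x) ∂μ
        - (∫ x, Real.exp (g x) ∂μ) * Real.log (∫ x, Real.exp (g x) ∂μ) ≤
      ∫ x, (‖fderiv ℝ g x‖ + ε) ^ 2 / (2 * α) * Real.exp (g x) ∂μ := by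
  have hgc : Continuous g := hg.continuous
  have hDc : Continuous (fderiv ℝ g) := hg.continuous_fderiv (by norm_num)
  set K : E → ℝ := fun x => (‖fderiv ℝ g x‖ + ε) ^ 2 / (2 * α) with hK
  have hKc : Continuous K := by fun_prop
  have hK0 : ∀ x, 0 ≤ K x := fun x => by positivity
  obtain ⟨C, hC0, hC⟩ : ∃ C, 0 < C ∧ ∀ x, K x ≤ C := by
    refine ⟨(L + ε) ^ 2 / (2 * α) + 1, by positivity, fun x => ?_⟩
    have : K x ≤ (L + ε) ^ 2 / (2 * α) := by
      simp only [hK]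
      gcongr
      exact hL x
    linarith
  have hexp : ∀ x, Real.exp (g x) ≤ Real.exp M := fun x =>
    Real.exp_le_exp.2 ((le_abs_self _).trans (hM x))
  have hintegral : ∀ (f : E → ℝ) (B : ℝ), Continuous f → (∀ x, |f x| ≤ B) →
      Integrable (fun x => f x * Real.exp (g x)) μ := fun f B hf hB =>
    integrable_of_continuous_of_bounded (M := B * Real.exp M) (by fun_prop) fun x => by
      rw [abs_mul, Real.abs_exp]
      exact mul_le_mul (hB x) (hexp x) (Real.exp_pos _).le ((abs_nonneg _).trans (hB x))
  have hi0 : Integrable (fun x => Real.exp (g x)) μ :=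
    integrable_exp_of_bounded hgc fun x => (le_abs_self _).trans (hM x)
  have hi1 := hintegral g M hgc hM
  have hi2 := hintegral K C hKc fun x => by rw [abs_of_nonneg (hK0 x)]; exact hC x
  have hi3 := hintegral (fun x => K x ^ 2) (C ^ 2) (by fun_prop) fun x => by
    rw [abs_of_nonneg (by positivity)]
    exact pow_le_pow_left₀ (hK0 x) (hC x) 2
  set Z := ∫ x, Real.exp (g x) ∂μ with hZ
  set A := ∫ x, g x * Real.exp (g x) ∂μ with hA
  set B := ∫ x, K x * Real.exp (g x) ∂μ with hB
  set D := ∫ x, K x ^ 2 * Real.exp (g x) ∂μ with hD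
  have hZ0 : 0 < Z := integral_exp_pos hi0
  have hpos : ∀ᶠ r in nhdsWithin (0 : ℝ) (Set.Ioi 0), 0 < Z + r * A := by
    refine Filter.Tendsto.eventually_const_lt (v := Z + 0 * A) (by simpa using hZ0) ?_
    exact ((tendsto_nhdsWithin_of_tendsto_nhds Filter.tendsto_id).mul_const _).const_add _
  have hsmall : ∀ᶠ r in nhdsWithin (0 : ℝ) (Set.Ioi 0), r * C < 1 := by
    refine Filter.Tendsto.eventually_lt_const (v := 0 * C) (by simp) ?_
    exact (tendsto_nhdsWithin_of_tendsto_nhds Filter.tendsto_id).mul_const _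
  have hlog : ∀ᶠ r in nhdsWithin (0 : ℝ) (Set.Ioi 0), Real.log (Z + (0 + r) * A) ≤
      (1 + (0 + r)) * Real.log (Z + (0 + r) * B + (0 + r) ^ 2 * D) := by
    filter_upwards [hμ.integral_exp_le hα hg hM hL hu hε, hpos, hsmall, self_mem_nhdsWithin]
      with r h1 h2 h3 hr
    have hr : 0 < r := hr
    rw [zero_add]
    have hl : Z + r * A ≤ ∫ x, Real.exp ((1 + r) * g x) ∂μ := by
      rw [hZ, hA, ← integral_const_mul, ← integral_add hi0 (hi1.const_mul r)]
      refine integral_mono (hi0.add (hi1.const_mul r))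
        (integrable_exp_of_bounded (M := (1 + r) * M) (by fun_prop) fun x => ?_) fun x => ?_
      · exact mul_le_mul_of_nonneg_left ((le_abs_self _).trans (hM x)) (by positivity)
      · have : Real.exp ((1 + r) * g x) = Real.exp (g x) * Real.exp (r * g x) := by
          rw [← Real.exp_add]
          ring_nf
        simp only [this]
        nlinarith [Real.add_one_le_exp (r * g x), Real.exp_pos (g x)]
    have hi02 : Integrable (fun x => Real.exp (g x) + r * (K x * Real.exp (g x))) μ :=
      hi0.add (hi2.const_mul r)
    have hup : ∫ x, Real.exp (g x + r * K x) ∂μ ≤ Z + r * B + r ^ 2 * D := by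
      rw [hZ, hB, hD, ← integral_const_mul, ← integral_const_mul,
        ← integral_add hi0 (hi2.const_mul r),
        ← integral_add hi02 (hi3.const_mul _)]
      refine integral_mono (integrable_exp_of_bounded (M := M + r * C) (by fun_prop) fun x => ?_)
        (hi02.add (hi3.const_mul _)) fun x => ?_
      · exact add_le_add ((le_abs_self _).trans (hM x))
          (mul_le_mul_of_nonneg_left (hC x) hr.le)
      · have hx0 : 0 ≤ r * K x := mul_nonneg hr.le (hK0 x)
        have hx1 : r * K x ≤ 1 :=
          (mul_le_mul_of_nonneg_left (hC x) hr.le).trans h3.le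
        have := Real.abs_exp_sub_one_sub_id_le (x := r * K x) (by rwa [abs_of_nonneg hx0])
        have := (abs_le.1 this).2
        simp only [Real.exp_add]
        nlinarith [Real.exp_pos (g x)]
    have hI0 : 0 < ∫ x, Real.exp ((1 + r) * g x) ∂μ := h2.trans_le hl
    have h4 : 1 / (1 + r) * Real.log (∫ x, Real.exp ((1 + r) * g x) ∂μ) ≤
        Real.log (Z + r * B + r ^ 2 * D) := by
      rw [← Real.log_rpow hI0]
      exact Real.log_le_log (Real.rpow_pos_of_pos hI0 _) (h1.trans hup)
    have h5 := Real.log_le_log h2 hl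
    have h6 : (1 + r) * (1 / (1 + r) * Real.log (∫ x, Real.exp ((1 + r) * g x) ∂μ)) =
        Real.log (∫ x, Real.exp ((1 + r) * g x) ∂μ) := by field_simp
    have h7 := mul_le_mul_of_nonneg_left h4 (by positivity : (0 : ℝ) ≤ 1 + r)
    rw [h6] at h7
    exact h5.trans h7
  have hd1 : HasDerivAt (fun r : ℝ => Real.log (Z + r * A)) (A / Z) 0 := by
    have := (((hasDerivAt_id (0 : ℝ)).mul_const A).const_add Z).log (by simpa using hZ0.ne')
    simpa using this
  have hd2 : HasDerivAt (fun r : ℝ => (1 + r) * Real.log (Z + r * B + r ^ 2 * D))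
      (Real.log Z + B / Z) 0 := by
    have h1 := ((((hasDerivAt_id (0 : ℝ)).mul_const B).const_add Z).add
      (((hasDerivAt_id (0 : ℝ)).pow 2).mul_const D)).log (by simpa using hZ0.ne')
    have := ((hasDerivAt_id (0 : ℝ)).const_add 1).mul h1
    simp only [id_eq, add_zero] at this
    exact this.congr_deriv (by simp)
  have := deriv_le_of_eventually_le_right hd1 hd2 (by simp) hlog
  have h8 := mul_le_mul_of_nonneg_left this hZ0.le
  have h9 : Z * (A / Z) = A := by field_simp
  have h10 : Z * (Real.log Z + B / Z) = Z * Real.log Z + B := by field_simp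
  linarith

/-- The logarithmic Sobolev inequality for bounded functions with bounded, uniformly continuous
derivative. -/
theorem HopfLaxInequality.logSobolev {E : Type*} [NormedAddCommGroup E] [NormedSpace ℝ E]
    [MeasurableSpace E] [BorelSpace E] {α : ℝ} (hα : 0 < α)
    {μ : Measure E} [IsProbabilityMeasure μ] (hμ : HopfLaxInequality α μ) {g : E → ℝ}
    (hg : ContDiff ℝ 1 g) {M L : ℝ} (hM : ∀ x, |g x| ≤ M) (hL : ∀ x, ‖fderiv ℝ g x‖ ≤ L)
    (hu : UniformContinuous (fderiv ℝ g)) :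
    ∫ x, g x * Real.exp (g x) ∂μ
        - (∫ x, Real.exp (g x) ∂μ) * Real.log (∫ x, Real.exp (g x) ∂μ) ≤
      1 / (2 * α) * ∫ x, ‖fderiv ℝ g x‖ ^ 2 * Real.exp (g x) ∂μ := by
  have hgc : Continuous g := hg.continuous
  have hDc : Continuous (fderiv ℝ g) := hg.continuous_fderiv (by norm_num)
  have hexp : ∀ x, Real.exp (g x) ≤ Real.exp M := fun x =>
    Real.exp_le_exp.2 ((le_abs_self _).trans (hM x))
  have hintegral : ∀ (f : E → ℝ) (B : ℝ), Continuous f → (∀ x, |f x| ≤ B) →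
      Integrable (fun x => f x * Real.exp (g x)) μ := fun f B hf hB =>
    integrable_of_continuous_of_bounded (M := B * Real.exp M) (by fun_prop) fun x => by
      rw [abs_mul, Real.abs_exp]
      exact mul_le_mul (hB x) (hexp x) (Real.exp_pos _).le ((abs_nonneg _).trans (hB x))
  have hi0 : Integrable (fun x => Real.exp (g x)) μ :=
    integrable_exp_of_bounded hgc fun x => (le_abs_self _).trans (hM x)
  have hi1 := hintegral (fun x => ‖fderiv ℝ g x‖) L (by fun_prop) fun x => by simpa using hL x
  have hi2 := hintegral (fun x => ‖fderiv ℝ g x‖ ^ 2) (L ^ 2) (by fun_prop) fun x => by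
    rw [abs_of_nonneg (by positivity)]
    exact pow_le_pow_left₀ (norm_nonneg _) (hL x) 2
  have hexpand : ∀ ε : ℝ, ∫ x, (‖fderiv ℝ g x‖ + ε) ^ 2 / (2 * α) * Real.exp (g x) ∂μ =
      1 / (2 * α) * (∫ x, ‖fderiv ℝ g x‖ ^ 2 * Real.exp (g x) ∂μ
        + (2 * ε) * ∫ x, ‖fderiv ℝ g x‖ * Real.exp (g x) ∂μ
        + ε ^ 2 * ∫ x, Real.exp (g x) ∂μ) := fun ε => by
    have hi12 : Integrable (fun x => ‖fderiv ℝ g x‖ ^ 2 * Real.exp (g x)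
        + (2 * ε) * (‖fderiv ℝ g x‖ * Real.exp (g x))) μ := hi2.add (hi1.const_mul _)
    rw [← integral_const_mul, ← integral_const_mul, ← integral_add hi2 (hi1.const_mul _),
      ← integral_add hi12 (hi0.const_mul _), ← integral_const_mul]
    refine integral_congr_ae (Filter.Eventually.of_forall fun x => ?_)
    ring
  have hlim : Filter.Tendsto (fun ε : ℝ =>
      ∫ x, (‖fderiv ℝ g x‖ + ε) ^ 2 / (2 * α) * Real.exp (g x) ∂μ)
      (nhdsWithin 0 (Set.Ioi 0))
      (nhds (1 / (2 * α) * ∫ x, ‖fderiv ℝ g x‖ ^ 2 * Real.exp (g x) ∂μ)) := by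
    simp only [hexpand]
    refine tendsto_nhdsWithin_of_tendsto_nhds (Continuous.tendsto' (by fun_prop) _ _ ?_)
    simp
  refine ge_of_tendsto hlim ?_
  filter_upwards [self_mem_nhdsWithin] with ε hε
  exact hμ.logSobolev_add hα hg hM hL hu hε

theorem HopfLaxInequality.logSobolev_of_hasCompactSupport {E : Type*} [NormedAddCommGroup E]
    [NormedSpace ℝ E] [MeasurableSpace E] [BorelSpace E] {α : ℝ} (hα : 0 < α)
    {μ : Measure E} [IsProbabilityMeasure μ] (hμ : HopfLaxInequality α μ) {h : E → ℝ}
    (hh : ContDiff ℝ 1 h) (hsupp : HasCompactSupport h) (h0 : ∀ x, 0 ≤ h x) {ε : ℝ}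
    (hε : 0 < ε) :
    ∫ x, (h x + ε) * Real.log (h x + ε) ∂μ
        - (∫ x, (h x + ε) ∂μ) * Real.log (∫ x, (h x + ε) ∂μ) ≤
      1 / (2 * α) * ∫ x, ‖fderiv ℝ h x‖ ^ 2 / (h x + ε) ∂μ := by
  have hpos : ∀ x, 0 < h x + ε := fun x => by linarith [h0 x]
  have hDc : Continuous (fderiv ℝ h) := hh.continuous_fderiv (by norm_num)
  have hhc : Continuous h := hh.continuous
  obtain ⟨B, hB⟩ := hsupp.exists_bound_of_continuous hhc
  have hg : ContDiff ℝ 1 (fun x => Real.log (h x + ε)) :=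
    (hh.add contDiff_const).log fun x => (hpos x).ne'
  have hD : fderiv ℝ (fun x => Real.log (h x + ε)) = fun x => (h x + ε)⁻¹ • fderiv ℝ h x := by
    funext x
    exact (((hh.differentiable (by norm_num) x).hasFDerivAt.add_const ε).log (hpos x).ne').fderiv
  have hDc' : Continuous (fun x => (h x + ε)⁻¹ • fderiv ℝ h x) :=
    ((hhc.add continuous_const).inv₀ fun x => (hpos x).ne').smul hDc
  have hDs : HasCompactSupport (fun x => (h x + ε)⁻¹ • fderiv ℝ h x) :=
    HasCompactSupport.smul_left (f := fun x => (h x + ε)⁻¹) (hsupp.fderiv ℝ)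
  obtain ⟨L, hL⟩ := hDs.exists_bound_of_continuous hDc'
  have key := hμ.logSobolev hα hg (M := |Real.log ε| + |Real.log (B + ε)|) (L := L)
    (fun x => by
      have h1 : Real.log ε ≤ Real.log (h x + ε) := Real.log_le_log hε (by linarith [h0 x])
      have h2 : Real.log (h x + ε) ≤ Real.log (B + ε) :=
        Real.log_le_log (hpos x) (by linarith [(le_abs_self _).trans (hB x)])
      rw [abs_le]
      constructor
      · linarith [neg_abs_le (Real.log ε), abs_nonneg (Real.log (B + ε))]
      · linarith [le_abs_self (Real.log (B + ε)), abs_nonneg (Real.log ε)])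
    (fun x => by rw [hD]; exact hL x)
    (by rw [hD]; exact hDs.uniformContinuous_of_continuous hDc')
  have e1 : ∀ x, Real.exp (Real.log (h x + ε)) = h x + ε := fun x => Real.exp_log (hpos x)
  have e2 : ∀ x, ‖(h x + ε)⁻¹ • fderiv ℝ h x‖ ^ 2 * (h x + ε) =
      ‖fderiv ℝ h x‖ ^ 2 / (h x + ε) := fun x => by
    have := (hpos x).ne'
    rw [norm_smul, norm_inv, Real.norm_of_nonneg (hpos x).le]
    field_simp
  simp only [hD, e1, e2] at key
  simpa only [mul_comm (Real.log (h _ + ε)) (h _ + ε)] using key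

theorem exists_contDiff_cutoff_seq (E : Type*) [NormedAddCommGroup E] [InnerProductSpace ℝ E]
    [FiniteDimensional ℝ E] :
    ∃ (χ : ℕ → E → ℝ) (C : ℝ), (∀ n, ContDiff ℝ 1 (χ n)) ∧ (∀ n, HasCompactSupport (χ n)) ∧
      (∀ n x, 0 ≤ χ n x) ∧ (∀ n x, χ n x ≤ 1) ∧ (∀ n x, ‖fderiv ℝ (χ n) x‖ ≤ C) ∧
      ∀ x, ∀ᶠ n in Filter.atTop, χ n =ᶠ[nhds x] fun _ => 1 := by
  let b : ContDiffBump (0 : E) := ⟨1, 2, one_pos, one_lt_two⟩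
  have hb1 : ContDiff ℝ 1 b := b.contDiff
  obtain ⟨C, hC⟩ := (b.hasCompactSupport.fderiv ℝ).exists_bound_of_continuous
    (hb1.continuous_fderiv (by norm_num))
  have hc : ∀ n : ℕ, ((n : ℝ) + 1)⁻¹ ≠ 0 := fun n => by positivity
  refine ⟨fun n x => b (((n : ℝ) + 1)⁻¹ • x), C, fun n => hb1.comp (contDiff_const_smul _),
    fun n => b.hasCompactSupport.comp_smul (hc n), fun n x => b.nonneg, fun n x => b.le_one,
    fun n x => ?_, fun x => ?_⟩
  · rw [fderiv_comp_smul, norm_smul, Real.norm_of_nonneg (by positivity)]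
    calc ((n : ℝ) + 1)⁻¹ * ‖fderiv ℝ b (((n : ℝ) + 1)⁻¹ • x)‖ ≤ 1 * C := by
          refine mul_le_mul (inv_le_one_of_one_le₀ ?_) (hC _) (norm_nonneg _) zero_le_one
          linarith [n.cast_nonneg (α := ℝ)]
      _ = C := one_mul _
  · obtain ⟨N, hN⟩ := exists_nat_gt ‖x‖
    filter_upwards [Filter.eventually_ge_atTop N] with n hn
    have hxn : ‖x‖ < n := hN.trans_le (by exact_mod_cast hn)
    filter_upwards [continuous_norm.continuousAt.eventually_lt_const hxn] with y hy
    refine b.one_of_mem_closedBall ?_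
    rw [mem_closedBall_zero_iff, norm_smul, Real.norm_of_nonneg (by positivity),
      inv_mul_le_iff₀ (by positivity)]
    change ‖y‖ ≤ ((n : ℝ) + 1) * 1
    linarith

theorem abs_mul_log_le {f y : ℝ} (hf : 0 < f) (hy : 0 < y) (hyf : y ≤ f + 1) :
    |y * Real.log y| ≤ 2 + 2 * f + 2 * |f * Real.log f| := by
  rcases le_or_gt y 1 with h1 | h1
  · have := Real.abs_log_mul_self_lt y hy h1
    rw [mul_comm] at this
    linarith [abs_nonneg (f * Real.log f)]
  · have hl : 0 ≤ Real.log y := Real.log_nonneg h1.le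
    rw [abs_of_nonneg (by positivity)]
    rcases le_or_gt f 1 with h2 | h2
    · have := Real.log_le_sub_one_of_pos hy
      have h3 : y * Real.log y ≤ 2 * f :=
        mul_le_mul (by linarith) (by linarith) hl (by norm_num)
      linarith [abs_nonneg (f * Real.log f)]
    · have h3 : Real.log y ≤ 1 + Real.log f := by
        have h4 : Real.log y ≤ Real.log (2 * f) := Real.log_le_log hy (by linarith)
        rw [Real.log_mul (by norm_num) hf.ne'] at h4
        linarith [Real.log_two_lt_d9]
      have h5 : y * Real.log y ≤ (2 * f) * (1 + Real.log f) :=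
        mul_le_mul (by linarith) h3 hl (by positivity)
      linarith [le_abs_self (f * Real.log f)]

/-- The logarithmic Sobolev inequality for the density `exp g`, assuming finite entropy and
finite Fisher information. -/
theorem HopfLaxInequality.logSobolev_of_integrable {E : Type*} [NormedAddCommGroup E]
    [InnerProductSpace ℝ E] [FiniteDimensional ℝ E] [MeasurableSpace E] [BorelSpace E] {α : ℝ}
    (hα : 0 < α) {μ : Measure E} [IsProbabilityMeasure μ] (hμ : HopfLaxInequality α μ) {g : E → ℝ}
    (hg : ContDiff ℝ 1 g) (hone : ∫ x, Real.exp (g x) ∂μ = 1)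
    (hent : Integrable (fun x => g x * Real.exp (g x)) μ)
    (hfisher : Integrable (fun x => ‖fderiv ℝ g x‖ ^ 2 * Real.exp (g x)) μ) :
    ∫ x, g x * Real.exp (g x) ∂μ ≤ 1 / (2 * α) * ∫ x, ‖fderiv ℝ g x‖ ^ 2 * Real.exp (g x) ∂μ := by
  obtain ⟨χ, C, hχ, hχs, hχ0, hχ1, hχC, hχlim⟩ := exists_contDiff_cutoff_seq E
  have hi : Integrable (fun x => Real.exp (g x)) μ := integrable_of_integral_eq_one hone
  have hgd : Differentiable ℝ g := hg.differentiable (by norm_num)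
  have hχd : ∀ n, Differentiable ℝ (χ n) := fun n => (hχ n).differentiable (by norm_num)
  set ε : ℕ → ℝ := fun n => 1 / ((n : ℝ) + 1) with hεdef
  have hε : ∀ n, 0 < ε n := fun n => by positivity
  have hε1 : ∀ n, ε n ≤ 1 := fun n => by
    rw [hεdef]
    refine (div_le_one (by positivity)).2 ?_
    linarith [n.cast_nonneg (α := ℝ)]
  have hεlim : Filter.Tendsto ε Filter.atTop (nhds 0) := tendsto_one_div_add_atTop_nhds_zero_nat
  set h : ℕ → E → ℝ := fun n x => χ n x ^ 2 * Real.exp (g x) with hh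
  have hhC : ∀ n, ContDiff ℝ 1 (h n) := fun n => ((hχ n).pow 2).mul hg.exp
  have hhc : ∀ n, Continuous (h n) := fun n => (hhC n).continuous
  have hhDc : ∀ n, Continuous (fderiv ℝ (h n)) := fun n => (hhC n).continuous_fderiv (by norm_num)
  have hh0 : ∀ n x, 0 ≤ h n x := fun n x => by positivity
  have hhle : ∀ n x, h n x ≤ Real.exp (g x) := fun n x =>
    mul_le_of_le_one_left (Real.exp_pos _).le (pow_le_one₀ (hχ0 n x) (hχ1 n x))
  have hpos : ∀ n x, 0 < h n x + ε n := fun n x => by linarith [hh0 n x, hε n]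
  have hhs : ∀ n, HasCompactSupport (h n) := fun n => by
    have : HasCompactSupport (fun x => χ n x * (χ n x * Real.exp (g x))) := (hχs n).mul_right
    convert this using 2 with x
    ring
  have hheq : ∀ x, ∀ᶠ n in Filter.atTop, h n =ᶠ[nhds x] fun y => Real.exp (g y) := fun x => by
    filter_upwards [hχlim x] with n hn
    filter_upwards [hn] with y hy
    simp [hh, hy]
  have hlim : ∀ x, Filter.Tendsto (fun n => h n x + ε n) Filter.atTop
      (nhds (Real.exp (g x))) := fun x => by
    have : Filter.Tendsto (fun n => h n x) Filter.atTop (nhds (Real.exp (g x))) :=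
      tendsto_const_nhds.congr' ((hheq x).mono fun n hn => hn.self_of_nhds.symm)
    simpa using this.add hεlim
  have hlimD : ∀ x, Filter.Tendsto (fun n => ‖fderiv ℝ (h n) x‖ ^ 2 / (h n x + ε n)) Filter.atTop
      (nhds (‖fderiv ℝ g x‖ ^ 2 * Real.exp (g x))) := fun x => by
    have h1 : Filter.Tendsto (fun n => ‖fderiv ℝ (h n) x‖ ^ 2) Filter.atTop
        (nhds (‖Real.exp (g x) • fderiv ℝ g x‖ ^ 2)) :=
      tendsto_const_nhds.congr' ((hheq x).mono fun n hn => by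
        beta_reduce
        rw [hn.fderiv_eq, fderiv_exp (hgd x)])
    have h2 := h1.div (hlim x) (Real.exp_ne_zero _)
    have h3 : ‖fderiv ℝ g x‖ ^ 2 * Real.exp (g x) =
        ‖Real.exp (g x) • fderiv ℝ g x‖ ^ 2 / Real.exp (g x) := by
      rw [norm_smul, Real.norm_of_nonneg (Real.exp_pos _).le]
      have := Real.exp_ne_zero (g x)
      field_simp
    rw [h3]
    exact h2
  have hbound : ∀ n x, ‖fderiv ℝ (h n) x‖ ^ 2 / (h n x + ε n) ≤
      2 * (‖fderiv ℝ g x‖ ^ 2 * Real.exp (g x)) + 8 * C ^ 2 * Real.exp (g x) := fun n x => by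
    have hD : fderiv ℝ (h n) x = (χ n x ^ 2 * Real.exp (g x)) • fderiv ℝ g x
        + (2 * χ n x * Real.exp (g x)) • fderiv ℝ (χ n) x := by
      have h1 := ((hχd n x).hasFDerivAt.pow 2).mul (hgd x).hasFDerivAt.exp
      refine h1.fderiv.trans ?_
      ext v
      simp
      ring
    set f := Real.exp (g x)
    have hf : 0 < f := Real.exp_pos _
    set c := χ n x
    have hc0 : 0 ≤ c := hχ0 n x
    have hc1 : c ≤ 1 := hχ1 n x
    set a := ‖fderiv ℝ g x‖
    have ha : 0 ≤ a := norm_nonneg _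
    have hC0 : 0 ≤ C := (norm_nonneg _).trans (hχC n x)
    have h1 : ‖fderiv ℝ (h n) x‖ ≤ c ^ 2 * f * a + 2 * c * f * C := by
      rw [hD]
      refine (norm_add_le _ _).trans ?_
      rw [norm_smul, norm_smul, Real.norm_of_nonneg (by positivity),
        Real.norm_of_nonneg (by positivity)]
      gcongr
      exact hχC n x
    rw [div_le_iff₀ (hpos n x)]
    have h2 : ‖fderiv ℝ (h n) x‖ ^ 2 ≤ (c ^ 2 * f * a + 2 * c * f * C) ^ 2 := by gcongr
    have h3 : (c ^ 2 * f * a + 2 * c * f * C) ^ 2 ≤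
        2 * (c ^ 2 * f * a) ^ 2 + 2 * (2 * c * f * C) ^ 2 := by
      nlinarith [sq_nonneg (c ^ 2 * f * a - 2 * c * f * C)]
    have h4 : (c ^ 2 * f * a) ^ 2 ≤ (c * f * a) ^ 2 := by
      have : c ^ 2 ≤ c := by nlinarith
      gcongr
    have h5 : (2 * (a ^ 2 * f) + 8 * C ^ 2 * f) * (c ^ 2 * f) ≤
        (2 * (a ^ 2 * f) + 8 * C ^ 2 * f) * (h n x + ε n) := by
      gcongr
      linarith [hε n, show h n x = c ^ 2 * f from rfl]
    nlinarith
  have hconv0 : Filter.Tendsto (fun n => ∫ x, (h n x + ε n) ∂μ) Filter.atTop (nhds 1) := by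
    rw [← hone]
    refine tendsto_integral_of_dominated_convergence (fun x => Real.exp (g x) + 1)
      (fun n => ((hhc n).add continuous_const).measurable.aestronglyMeasurable)
      (hi.add (integrable_const 1)) (fun n => .of_forall fun x => ?_) (.of_forall hlim)
    rw [Real.norm_of_nonneg (hpos n x).le]
    linarith [hhle n x, hε1 n]
  have hconv1 : Filter.Tendsto (fun n => ∫ x, (h n x + ε n) * Real.log (h n x + ε n) ∂μ)
      Filter.atTop (nhds (∫ x, g x * Real.exp (g x) ∂μ)) := by
    refine tendsto_integral_of_dominated_convergence
      (fun x => 2 + 2 * Real.exp (g x) + 2 * |g x * Real.exp (g x)|)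
      (fun n => (Real.continuous_mul_log.comp
        ((hhc n).add continuous_const)).measurable.aestronglyMeasurable)
      (((integrable_const 2).add (hi.const_mul 2)).add (hent.abs.const_mul 2))
      (fun n => .of_forall fun x => ?_) (.of_forall fun x => ?_)
    · have := abs_mul_log_le (Real.exp_pos (g x)) (hpos n x) (by linarith [hhle n x, hε1 n])
      rwa [Real.log_exp, mul_comm (Real.exp (g x)) (g x)] at this
    · have := (Real.continuous_mul_log.tendsto (Real.exp (g x))).comp (hlim x)
      rwa [Real.log_exp, mul_comm (Real.exp (g x)) (g x)] at this
  have hconv2 : Filter.Tendsto (fun n => ∫ x, ‖fderiv ℝ (h n) x‖ ^ 2 / (h n x + ε n) ∂μ)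
      Filter.atTop (nhds (∫ x, ‖fderiv ℝ g x‖ ^ 2 * Real.exp (g x) ∂μ)) := by
    refine tendsto_integral_of_dominated_convergence _ (fun n => ?_)
      ((hfisher.const_mul 2).add (hi.const_mul (8 * C ^ 2)))
      (fun n => .of_forall fun x => ?_) (.of_forall hlimD)
    · exact (((hhDc n).norm.pow 2).div ((hhc n).add continuous_const)
        fun x => (hpos n x).ne').measurable.aestronglyMeasurable
    · rw [Real.norm_of_nonneg (div_nonneg (by positivity) (hpos n x).le)]
      exact hbound n x
  have hconv3 := (Real.continuous_mul_log.tendsto 1).comp hconv0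
  rw [Real.log_one, mul_zero] at hconv3
  have := le_of_tendsto_of_tendsto' (hconv1.sub hconv3) (hconv2.const_mul (1 / (2 * α)))
    fun n => hμ.logSobolev_of_hasCompactSupport hα (hhC n) (hhs n) (hh0 n) (hε n)
  simpa using this

theorem three_mul_sub_one_sq_le {f : ℝ} (hf : 0 < f) :
    3 * (f - 1) ^ 2 ≤ (2 * f + 4) * (f * Real.log f - f + 1) := by
  set H : ℝ → ℝ := fun x => (2 * x + 4) * (x * Real.log x - x + 1) - 3 * (x - 1) ^ 2 with hH
  set H' : ℝ → ℝ := fun x => (4 * x + 4) * Real.log x - 8 * x + 8 with hH'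
  have h1 : ∀ x : ℝ, 0 < x → HasDerivAt H (H' x) x := fun x hx => by
    have hl := Real.hasDerivAt_log hx.ne'
    have hi := hasDerivAt_id' x
    have := ((((hi.const_mul 2).add_const 4).mul (((hi.mul hl).sub hi).add_const 1))).sub
      (((hi.sub_const 1).pow 2).const_mul 3)
    refine this.congr_deriv ?_
    simp only [hH', Pi.sub_apply, Pi.mul_apply]
    field_simp
    ring
  have h2 : ∀ x : ℝ, 0 < x → HasDerivAt H' (4 * (Real.log x + x⁻¹ - 1)) x := fun x hx => by
    have hl := Real.hasDerivAt_log hx.ne'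
    have hi := hasDerivAt_id' x
    have := (((((hi.const_mul 4).add_const 4).mul hl).sub (hi.const_mul 8)).add_const 8)
    refine this.congr_deriv ?_
    field_simp
    ring
  have hmono : MonotoneOn H' (Set.Ioi 0) := by
    refine monotoneOn_of_deriv_nonneg (convex_Ioi 0)
      (fun x hx => (h2 x hx).continuousAt.continuousWithinAt)
      (fun x hx => (h2 x (interior_subset hx)).differentiableAt.differentiableWithinAt)
      fun x hx => ?_
    have hx : 0 < x := interior_subset hx
    rw [(h2 x hx).deriv]
    linarith [Real.one_sub_inv_le_log_of_pos hx]
  have hH1 : H 1 = 0 := by simp [hH]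
  have hH'1 : H' 1 = 0 := by simp [hH']
  have hone : (1 : ℝ) ∈ Set.Ioi (0 : ℝ) := Set.mem_Ioi.2 one_pos
  have key : 0 ≤ H f := by
    rcases le_total 1 f with h | h
    · have : MonotoneOn H (Set.Ici 1) := by
        refine monotoneOn_of_deriv_nonneg (convex_Ici 1)
          (fun x hx => (h1 x (one_pos.trans_le hx)).continuousAt.continuousWithinAt)
          (fun x hx => (h1 x (one_pos.trans_le
            (interior_subset hx))).differentiableAt.differentiableWithinAt) fun x hx => ?_
        have hx : 1 ≤ x := interior_subset hx
        rw [(h1 x (by linarith)).deriv, ← hH'1]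
        exact hmono hone (Set.mem_Ioi.2 (by linarith)) hx
      rw [← hH1]
      exact this Set.self_mem_Ici h h
    · have : AntitoneOn H (Set.Ioc 0 1) := by
        refine antitoneOn_of_deriv_nonpos (convex_Ioc 0 1)
          (fun x hx => (h1 x hx.1).continuousAt.continuousWithinAt)
          (fun x hx => (h1 x (interior_subset hx).1).differentiableAt.differentiableWithinAt)
          fun x hx => ?_
        have hx : x ∈ Set.Ioc (0 : ℝ) 1 := interior_subset hx
        rw [(h1 x hx.1).deriv, ← hH'1]
        exact hmono hx.1 hone hx.2
      rw [← hH1]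
      exact this ⟨hf, h⟩ ⟨one_pos, le_rfl⟩ h
  linarith [show H f = (2 * f + 4) * (f * Real.log f - f + 1) - 3 * (f - 1) ^ 2 from rfl]

theorem abs_sub_le_mul_log_div {p q : ℝ} (hp : 0 < p) (hq : 0 < q) {c : ℝ} (hc : 0 < c) :
    |p - q| ≤ c * ((2 * p + 4 * q) / 6) + (p * Real.log (p / q) - p + q) / (2 * c) := by
  set A := (2 * p + 4 * q) / 6 with hA
  set B := p * Real.log (p / q) - p + q with hB
  have hA0 : 0 < A := by positivity
  have h1 : (p - q) ^ 2 ≤ 2 * A * B := by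
    have h := three_mul_sub_one_sq_le (div_pos hp hq)
    have e1 : q ^ 2 * (3 * (p / q - 1) ^ 2) = 3 * (p - q) ^ 2 := by field_simp
    have e2 : q ^ 2 * ((2 * (p / q) + 4) * (p / q * Real.log (p / q) - p / q + 1)) =
        6 * A * B := by
      rw [hA, hB]
      field_simp
    have := mul_le_mul_of_nonneg_left h (sq_nonneg q)
    rw [e1, e2] at this
    linarith
  have hB0 : 0 ≤ B := by
    by_contra! h
    nlinarith [sq_nonneg (p - q), mul_pos_of_neg_of_neg h (neg_lt_zero.2 hA0)]
  refine abs_le_of_sq_le_sq (h1.trans ?_) (by positivity)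
  have h2 : 0 ≤ (c * A - B / (2 * c)) ^ 2 := sq_nonneg _
  have h3 : c * A * (B / (2 * c)) = A * B / 2 := by field_simp
  nlinarith

/-- Pinsker's inequality for probability densities. -/
theorem integral_abs_sub_sq_le {E : Type*} [MeasurableSpace E] {ν : Measure E} {p q : E → ℝ}
    (hp : ∀ x, 0 < p x) (hq : ∀ x, 0 < q x) (hp1 : ∫ x, p x ∂ν = 1) (hq1 : ∫ x, q x ∂ν = 1)
    (hi : Integrable (fun x => p x * Real.log (p x / q x)) ν) :
    1 / 2 * (∫ x, |p x - q x| ∂ν) ^ 2 ≤ ∫ x, p x * Real.log (p x / q x) ∂ν := by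
  have hpi : Integrable p ν := integrable_of_integral_eq_one hp1
  have hqi : Integrable q ν := integrable_of_integral_eq_one hq1
  set K := ∫ x, p x * Real.log (p x / q x) ∂ν with hK
  set y := ∫ x, |p x - q x| ∂ν with hy
  have hy0 : 0 ≤ y := integral_nonneg fun x => abs_nonneg _
  have hle : ∀ c : ℝ, 0 < c → y ≤ c + K / (2 * c) := fun c hc => by
    have h1 : Integrable (fun x => c * ((2 * p x + 4 * q x) / 6)) ν :=
      (((hpi.const_mul 2).add (hqi.const_mul 4)).div_const 6).const_mul c
    have h2 : Integrable (fun x => (p x * Real.log (p x / q x) - p x + q x) / (2 * c)) ν :=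
      ((hi.sub hpi).add hqi).div_const (2 * c)
    have h3 := integral_mono (hpi.sub hqi).abs (h1.add h2)
      fun x => abs_sub_le_mul_log_div (hp x) (hq x) hc
    have h4 : Integrable (fun x => p x * Real.log (p x / q x) - p x) ν := hi.sub hpi
    refine h3.trans_eq ?_
    rw [integral_add' h1 h2, integral_const_mul, integral_div, integral_div,
      integral_add (hpi.const_mul 2) (hqi.const_mul 4), integral_const_mul, integral_const_mul,
      integral_add h4 hqi, integral_sub hi hpi, hp1, hq1]
    ring
  have hmul : ∀ c : ℝ, 0 < c → y * (2 * c) ≤ 2 * c ^ 2 + K := fun c hc => by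
    have := mul_le_mul_of_nonneg_right (hle c hc) (by positivity : 0 ≤ 2 * c)
    rw [add_mul, div_mul_cancel₀ _ (by positivity)] at this
    linarith
  rcases hy0.eq_or_lt with h | h
  · rw [← h]
    by_contra! hn
    have hK0 : K < 0 := by simpa using hn
    have h1 := hmul (Real.sqrt (-K / 4)) (Real.sqrt_pos.2 (by linarith))
    rw [Real.sq_sqrt (by linarith), ← h] at h1
    linarith
  · have := hmul (y / 2) (by positivity)
    linarith

/-- The logarithmic Sobolev inequality for an `α`-strongly logconcave density `exp (-Φ)`. -/
theorem integral_mul_log_add_le {d : ℕ} {Φ : EuclideanSpace ℝ (Fin d) → ℝ}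
    (hΦ : ContDiff ℝ 2 Φ) {α : ℝ} (hα : 0 < α)
    (hconv : ∀ x v : EuclideanSpace ℝ (Fin d), α * ‖v‖ ^ 2 ≤ iteratedFDeriv ℝ 2 Φ x ![v, v])
    (hΦ1 : ∫ x, Real.exp (-Φ x) = 1) {p : EuclideanSpace ℝ (Fin d) → ℝ} (hp : ∀ x, 0 < p x)
    (hpC : ContDiff ℝ 1 p) (hp1 : ∫ x, p x = 1)
    (hent : Integrable fun x => p x * (Real.log (p x) + Φ x))
    (hfisher : Integrable fun x => p x * ‖fderiv ℝ (fun y => Real.log (p y) + Φ y) x‖ ^ 2) :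
    ∫ x, p x * (Real.log (p x) + Φ x) ≤
      1 / (2 * α) * ∫ x, p x * ‖fderiv ℝ (fun y => Real.log (p y) + Φ y) x‖ ^ 2 := by
  have hΦc : Continuous Φ := hΦ.continuous
  have hΦi : Integrable fun x => Real.exp (-Φ x) := integrable_of_integral_eq_one hΦ1
  have hprob : IsProbabilityMeasure
      (volume.withDensity fun x => ENNReal.ofReal (Real.exp (-Φ x))) := by
    refine ⟨?_⟩
    rw [withDensity_apply _ .univ, setLIntegral_univ,
      ← ofReal_integral_eq_lintegral_ofReal hΦi (.of_forall fun x => (Real.exp_pos _).le),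
      hΦ1, ENNReal.ofReal_one]
  set μ := (volume : Measure (EuclideanSpace ℝ (Fin d))).withDensity
    fun x => ENNReal.ofReal (Real.exp (-Φ x)) with hμ
  have hmeas : Measurable fun x => ENNReal.ofReal (Real.exp (-Φ x)) := by fun_prop
  have hfin : ∀ᵐ x, ENNReal.ofReal (Real.exp (-Φ x)) < ∞ :=
    .of_forall fun x => ENNReal.ofReal_lt_top
  set g : EuclideanSpace ℝ (Fin d) → ℝ := fun x => Real.log (p x) + Φ x with hg
  have hgC : ContDiff ℝ 1 g := (hpC.log fun x => (hp x).ne').add (hΦ.of_le (by norm_num))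
  have hexp : ∀ x, Real.exp (-Φ x) * Real.exp (g x) = p x := fun x => by
    rw [← Real.exp_add, hg]
    simp [Real.exp_log (hp x)]
  have hsmul : ∀ (f : EuclideanSpace ℝ (Fin d) → ℝ) (x : EuclideanSpace ℝ (Fin d)),
      (ENNReal.ofReal (Real.exp (-Φ x))).toReal • (f x * Real.exp (g x)) = p x * f x :=
    fun f x => by
      rw [ENNReal.toReal_ofReal (Real.exp_pos _).le, smul_eq_mul, ← hexp x]
      ring
  have hintegral : ∀ f : EuclideanSpace ℝ (Fin d) → ℝ,
      ∫ x, f x * Real.exp (g x) ∂μ = ∫ x, p x * f x := fun f => by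
    rw [hμ, integral_withDensity_eq_integral_toReal_smul hmeas hfin]
    exact integral_congr_ae (.of_forall (hsmul f))
  have hintegrable : ∀ f : EuclideanSpace ℝ (Fin d) → ℝ, Integrable (fun x => p x * f x) →
      Integrable (fun x => f x * Real.exp (g x)) μ := fun f hf => by
    rw [hμ, integrable_withDensity_iff_integrable_smul' hmeas hfin]
    exact hf.congr (.of_forall fun x => (hsmul f x).symm)
  have hHL := (prekopaLeindler_euclideanSpace d).hopfLaxInequality hΦ hα hconv
  have key := hHL.logSobolev_of_integrable hα hgC
    (by simpa [hp1] using hintegral fun _ => 1) (hintegrable g hent)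
    (hintegrable (fun x => ‖fderiv ℝ g x‖ ^ 2) hfisher)
  rwa [hintegral g, hintegral fun x => ‖fderiv ℝ g x‖ ^ 2] at key

theorem mul_norm_sq_le_of_posSemidef_sub {d : ℕ} {A : Matrix (Fin d) (Fin d) ℝ} {c : ℝ}
    (hA : (A - c • (1 : Matrix (Fin d) (Fin d) ℝ)).PosSemidef) (v : EuclideanSpace ℝ (Fin d)) :
    c * ‖v‖ ^ 2 ≤ ∑ i, ∑ j, v i * A i j * v j := by
  have h := hA.dotProduct_mulVec_nonneg (fun i => v i)
  have e : (star fun i => v i) ⬝ᵥ (A - c • (1 : Matrix (Fin d) (Fin d) ℝ)).mulVec (fun i => v i) =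
      (∑ i, ∑ j, v i * A i j * v j) - c * ‖v‖ ^ 2 := by
    rw [Matrix.sub_mulVec, dotProduct_sub, Matrix.smul_mulVec, Matrix.one_mulVec,
      dotProduct_smul, EuclideanSpace.real_norm_sq_eq]
    simp only [dotProduct, Matrix.mulVec, Finset.mul_sum, smul_eq_mul, Pi.star_apply,
      star_trivial, mul_assoc, sq]
  rw [e] at h
  linarith

theorem le_mul_exp_of_hasDerivAt_le {F F' : ℝ → ℝ} {c : ℝ}
    (hF : ∀ t, 0 ≤ t → HasDerivAt F (F' t) t) (hle : ∀ t, 0 ≤ t → F' t ≤ -c * F t) {t : ℝ}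
    (ht : 0 ≤ t) : F t ≤ F 0 * Real.exp (-(c * t)) := by
  have hG : ∀ s, 0 ≤ s → HasDerivAt (fun s => F s * Real.exp (c * s))
      (F' s * Real.exp (c * s) + F s * (Real.exp (c * s) * (c * 1))) s := fun s hs =>
    (hF s hs).mul ((hasDerivAt_id' s).const_mul c).exp
  have hanti : AntitoneOn (fun s => F s * Real.exp (c * s)) (Set.Ici 0) := by
    refine antitoneOn_of_deriv_nonpos (convex_Ici 0)
      (fun s hs => (hG s hs).continuousAt.continuousWithinAt)
      (fun s hs => (hG s (interior_subset hs)).differentiableAt.differentiableWithinAt)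
      fun s hs => ?_
    rw [(hG s (interior_subset hs)).deriv]
    nlinarith [hle s (interior_subset hs), Real.exp_pos (c * s)]
  have h := hanti Set.self_mem_Ici ht ht
  simp only [mul_zero, Real.exp_zero, mul_one] at h
  rw [Real.exp_neg, ← div_eq_mul_inv, le_div_iff₀ (Real.exp_pos _)]
  exact h

end

/-- Exponential `L¹` convergence of the preconditioned (affine-invariant) Wasserstein gradient
flow of the KL divergence towards an `α`-strongly logconcave target, when the preconditioner
is bounded below by `λ·I`: combining the logarithmic Sobolev inequality with Pinsker's
inequality yields `½‖ρ_t − ρ_post‖_{L¹}² ≤ KL[ρ₀‖ρ_post]·e^{−2αλt}`. -/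
theorem preconditioned_wasserstein_L1_convergence {d : ℕ}
    (ΦR : EuclideanSpace ℝ (Fin d) → ℝ) (hΦ : ContDiff ℝ 2 ΦR)
    (α : ℝ) (hα : 0 < α)
    -- α-strong logconcavity of ρ_post: Hess Φ_R ⪰ α I
    (hconv : ∀ (θ v : EuclideanSpace ℝ (Fin d)),
      α * ‖v‖ ^ 2 ≤ iteratedFDeriv ℝ 2 ΦR θ ![v, v])
    (ρpost : EuclideanSpace ℝ (Fin d) → ℝ) (hpost : ∀ θ, ρpost θ = Real.exp (-ΦR θ))
    (hpostint : (∫ θ, ρpost θ) = 1)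
    (lam : ℝ) (hlam : 0 < lam)
    (P : ℝ → EuclideanSpace ℝ (Fin d) → Matrix (Fin d) (Fin d) ℝ)
    (hPsymm : ∀ t θ, (P t θ).IsSymm)
    -- P_t(θ) ⪰ λ I
    (hPlb : ∀ t θ, (P t θ - lam • (1 : Matrix (Fin d) (Fin d) ℝ)).PosSemidef)
    (ρ : ℝ → EuclideanSpace ℝ (Fin d) → ℝ)
    (hρpos : ∀ t θ, 0 < ρ t θ)
    (hρC1 : ∀ t, ContDiff ℝ 1 (ρ t))
    (hρint : ∀ t, (∫ θ, ρ t θ) = 1)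
    -- u_t = ∇log ρ_t − ∇log ρ_post
    (u : ℝ → EuclideanSpace ℝ (Fin d) → EuclideanSpace ℝ (Fin d))
    (hu : ∀ t θ, u t θ =
      gradient (fun x => Real.log (ρ t x)) θ - gradient (fun x => Real.log (ρpost x)) θ)
    -- F(t) = KL[ρ_t ‖ ρ_post], finite, satisfying the dissipation identity
    (F : ℝ → ℝ)
    (hFdef : ∀ t, F t = ∫ θ, ρ t θ * Real.log (ρ t θ / ρpost θ))
    (hFint : ∀ t, 0 ≤ t → Integrable (fun θ => ρ t θ * Real.log (ρ t θ / ρpost θ)))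
    (hdissInt : ∀ t, 0 ≤ t →
      Integrable (fun θ => ρ t θ * ∑ i, ∑ j, u t θ i * P t θ i j * u t θ j))
    (hF' : ∀ t, 0 ≤ t → HasDerivAt F
      (-∫ θ, ρ t θ * ∑ i, ∑ j, u t θ i * P t θ i j * u t θ j) t) :
    ∀ t, 0 ≤ t →
      (1 / 2) * (∫ θ, |ρ t θ - ρpost θ|) ^ 2 ≤ F 0 * Real.exp (-(2 * α * lam * t)) := by
  have hpostpos : ∀ θ, 0 < ρpost θ := fun θ => by
    rw [hpost]
    exact Real.exp_pos _
  have hlogpost : (fun x => Real.log (ρpost x)) = fun x => -ΦR x := by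
    funext x
    rw [hpost, Real.log_exp]
  have hlogdiv : ∀ t θ, Real.log (ρ t θ / ρpost θ) = Real.log (ρ t θ) + ΦR θ := fun t θ => by
    rw [Real.log_div (hρpos t θ).ne' (hpostpos θ).ne', hpost, Real.log_exp, sub_neg_eq_add]
  have hΦd : Differentiable ℝ ΦR := hΦ.differentiable (by norm_num)
  have hlogC : ∀ t, ContDiff ℝ 1 fun x => Real.log (ρ t x) := fun t =>
    (hρC1 t).log fun x => (hρpos t x).ne'
  have hunorm : ∀ t θ, ‖u t θ‖ = ‖fderiv ℝ (fun y => Real.log (ρ t y) + ΦR y) θ‖ := fun t θ => by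
    have hd : DifferentiableAt ℝ (fun y => Real.log (ρ t y)) θ :=
      (hlogC t).differentiable (by norm_num) θ
    rw [hu, hlogpost, gradient, gradient, ← map_sub, LinearIsometryEquiv.norm_map,
      fderiv_fun_neg, sub_neg_eq_add, fderiv_fun_add hd (hΦd θ)]
  have hgC : ∀ t, ContDiff ℝ 1 fun y => Real.log (ρ t y) + ΦR y := fun t =>
    (hlogC t).add (hΦ.of_le (by norm_num))
  have hlower : ∀ t θ,
      lam * (ρ t θ * ‖fderiv ℝ (fun y => Real.log (ρ t y) + ΦR y) θ‖ ^ 2) ≤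
        ρ t θ * ∑ i, ∑ j, u t θ i * P t θ i j * u t θ j := fun t θ => by
    have := mul_le_mul_of_nonneg_left (mul_norm_sq_le_of_posSemidef_sub (hPlb t θ) (u t θ))
      (hρpos t θ).le
    rw [hunorm] at this
    linarith
  have hfisher : ∀ t, 0 ≤ t → Integrable fun θ =>
      ρ t θ * ‖fderiv ℝ (fun y => Real.log (ρ t y) + ΦR y) θ‖ ^ 2 := fun t ht => by
    refine ((hdissInt t ht).const_mul lam⁻¹).mono'
      (((hρC1 t).continuous.mul (((hgC t).continuous_fderiv
        (by norm_num)).norm.pow 2)).measurable.aestronglyMeasurable) (.of_forall fun θ => ?_)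
    rw [Real.norm_of_nonneg (mul_nonneg (hρpos t θ).le (sq_nonneg _)), ← div_eq_inv_mul,
      le_div_iff₀' hlam]
    exact hlower t θ
  have hLSI : ∀ t, 0 ≤ t → -∫ θ, ρ t θ * ∑ i, ∑ j, u t θ i * P t θ i j * u t θ j ≤
      -(2 * α * lam) * F t := fun t ht => by
    have h1 := integral_mul_log_add_le hΦ hα hconv (by simpa only [hpost] using hpostint)
      (hρpos t) (hρC1 t) (hρint t) (by simpa only [hlogdiv] using hFint t ht) (hfisher t ht)
    have h2 := integral_mono ((hfisher t ht).const_mul lam) (hdissInt t ht) (hlower t)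
    have h3 : F t = ∫ θ, ρ t θ * (Real.log (ρ t θ) + ΦR θ) := by
      rw [hFdef]
      simp only [hlogdiv]
    rw [integral_const_mul] at h2
    rw [← h3, div_mul_eq_mul_div, one_mul, le_div_iff₀ (by positivity)] at h1
    have h4 := mul_le_mul_of_nonneg_left h1 hlam.le
    linarith
  intro t ht
  calc (1 / 2) * (∫ θ, |ρ t θ - ρpost θ|) ^ 2
      ≤ ∫ θ, ρ t θ * Real.log (ρ t θ / ρpost θ) :=
        integral_abs_sub_sq_le (hρpos t) hpostpos (hρint t) hpostint (hFint t ht)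
    _ = F t := (hFdef t).symm
    _ ≤ F 0 * Real.exp (-(2 * α * lam * t)) := le_mul_exp_of_hasDerivAt_le hF' hLSI ht
end

section
/- Let A ∈ ℝ^{d×d} be invertible, b ∈ ℝ^d, and φ(θ) = Aθ + b. Let P assign to each θ ∈ ℝ^d and each positive probability density ρ on ℝ^d a symmetric matrix P(θ,ρ) ∈ ℝ^{d×d}, and assume the transformation law P(φ(θ), φ#ρ) = A·P(θ,ρ)·Aᵀ holds for all θ and ρ. Let ρ_post be a twice continuously differentiable positive probability density and let ρ : ℝ × ℝ^d → (0,∞) be such that each ρ_t := ρ(t,·) is a positive probability density, t ↦ ρ(t,θ) is differentiable for each θ, the vector field v_t(θ) := ρ_t(θ)·P(θ,ρ_t)·(∇log ρ_t(θ) − ∇log ρ_post(θ)) is continuously differentiable in θ, and ∂_t ρ_t(θ) = div_θ v_t(θ) for all t, θ (the preconditioned Wasserstein gradient flow of the KL divergence). Define ρ̃_t := φ#ρ_t and ρ̃_post := φ#ρ_post. Then for all t and all θ̃ ∈ ℝ^d, ∂_t ρ̃_t(θ̃) = div_{θ̃}( ρ̃_t(θ̃)·P(θ̃, ρ̃_t)·(∇log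 ρ̃_t(θ̃) − ∇log ρ̃_post(θ̃)) ); i.e. the preconditioned Wasserstein gradient flow is affine invariant. -/
open MeasureTheory

/-- The gradient of a scalar field on `ℝ^d`, as the vector of partial derivatives. -/
noncomputable def gradv {d : ℕ} (f : (Fin d → ℝ) → ℝ) (θ : Fin d → ℝ) : Fin d → ℝ :=
  fun i => fderiv ℝ f θ (Pi.single i 1)

/-- The divergence of a vector field on `ℝ^d`. -/
noncomputable def divv {d : ℕ} (v : (Fin d → ℝ) → (Fin d → ℝ)) (θ : Fin d → ℝ) : ℝ :=
  ∑ i, fderiv ℝ (fun x => v x i) θ (Pi.single i 1)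

/-- An everywhere-positive probability density on `ℝ^d`. -/
def IsPosDensity {d : ℕ} (ρ : (Fin d → ℝ) → ℝ) : Prop :=
  (∀ θ, 0 < ρ θ) ∧ (∫ θ, ρ θ) = 1

/-- Pushforward of a density under the invertible affine map `θ ↦ Aθ + b`. -/
noncomputable def pushfwd {d : ℕ} (A : Matrix (Fin d) (Fin d) ℝ) (b : Fin d → ℝ)
    (ρ : (Fin d → ℝ) → ℝ) : (Fin d → ℝ) → ℝ :=
  fun θ' => ρ (A⁻¹.mulVec (θ' - b)) * |A.det|⁻¹

/-- The derivative of the inverse affine map `x ↦ A⁻¹(x - b)`. -/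
lemma hasFDerivAt_inv_mulVec_sub {d : ℕ} (A : Matrix (Fin d) (Fin d) ℝ) (b x : Fin d → ℝ) :
    HasFDerivAt (fun y => A⁻¹.mulVec (y - b)) (A⁻¹.mulVecLin.toContinuousLinearMap) x := by
  simpa using (A⁻¹.mulVecLin.toContinuousLinearMap.hasFDerivAt (x := x - b)).comp x
    ((hasFDerivAt_id x).sub_const b)

/-- Chain rule for the derivative of a scalar function precomposed with `x ↦ A⁻¹(x - b)`. -/
lemma fderiv_comp_inv_mulVec_sub {d : ℕ} (A : Matrix (Fin d) (Fin d) ℝ) (b x : Fin d → ℝ)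
    {f : (Fin d → ℝ) → ℝ} (hf : DifferentiableAt ℝ f (A⁻¹.mulVec (x - b))) (w : Fin d → ℝ) :
    fderiv ℝ (fun y => f (A⁻¹.mulVec (y - b))) x w =
      fderiv ℝ f (A⁻¹.mulVec (x - b)) (A⁻¹.mulVec w) := by
  have h := hf.hasFDerivAt.comp x (hasFDerivAt_inv_mulVec_sub A b x)
  have h' := congrArg (fun L : (Fin d → ℝ) →L[ℝ] ℝ => L w) h.fderiv
  simpa [Function.comp_def] using h'

lemma fderiv_apply_eq_gradv_dotProduct {d : ℕ} (f : (Fin d → ℝ) → ℝ) (θ w : Fin d → ℝ) :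
    fderiv ℝ f θ w = gradv f θ ⬝ᵥ w := by
  conv_lhs => rw [pi_eq_sum_univ' w]
  simp only [map_sum, map_smul, smul_eq_mul, dotProduct, gradv]
  refine Finset.sum_congr rfl fun i _ => ?_
  rw [mul_comm]

/-- The score of a pushforward density is `A⁻ᵀ` times the score of the density. -/
lemma transpose_mulVec_gradv_log_pushfwd {d : ℕ} (A : Matrix (Fin d) (Fin d) ℝ)
    (hA : IsUnit A.det) (b x : Fin d → ℝ) {ρ : (Fin d → ℝ) → ℝ} (hpos : ∀ θ, 0 < ρ θ)
    (hρ : Differentiable ℝ ρ) :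
    A.transpose.mulVec (gradv (fun y => Real.log (pushfwd A b ρ y)) x) =
      gradv (fun y => Real.log (ρ y)) (A⁻¹.mulVec (x - b)) := by
  have hc : |A.det|⁻¹ ≠ 0 := inv_ne_zero (abs_ne_zero.mpr hA.ne_zero)
  have hlog : (fun y => Real.log (pushfwd A b ρ y)) =
      fun y => Real.log (ρ (A⁻¹.mulVec (y - b))) + Real.log |A.det|⁻¹ :=
    funext fun y => Real.log_mul (hpos _).ne' hc
  have hd : DifferentiableAt ℝ (fun y => Real.log (ρ y)) (A⁻¹.mulVec (x - b)) :=
    (hρ _).log (hpos _).ne'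
  ext i
  have h : A.transpose.mulVec (gradv (fun y => Real.log (pushfwd A b ρ y)) x) i =
      fderiv ℝ (fun y => Real.log (pushfwd A b ρ y)) x (A.mulVec (Pi.single i 1)) := by
    rw [fderiv_apply_eq_gradv_dotProduct, Matrix.mulVec_single_one, dotProduct_comm]
    rfl
  rw [h, hlog, fderiv_add_const,
    fderiv_comp_inv_mulVec_sub A b x (f := fun y => Real.log (ρ y)) hd,
    Matrix.mulVec_mulVec, Matrix.nonsing_inv_mul A hA, Matrix.one_mulVec]
  rfl

/-- Divergence is invariant under the Piola-type transform `x ↦ A v(A⁻¹(x - b))`. -/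
lemma divv_smul_mulVec_comp {d : ℕ} (A : Matrix (Fin d) (Fin d) ℝ) (hA : IsUnit A.det)
    (b x : Fin d → ℝ) (c : ℝ) {v : (Fin d → ℝ) → (Fin d → ℝ)} (hv : Differentiable ℝ v) :
    divv (fun y => c • A.mulVec (v (A⁻¹.mulVec (y - b)))) x =
      c * divv v (A⁻¹.mulVec (x - b)) := by
  have hvj (j : Fin d) : Differentiable ℝ fun y => v y j := differentiable_pi.mp hv j
  have hcomp (j : Fin d) : DifferentiableAt ℝ (fun y => v (A⁻¹.mulVec (y - b)) j) x :=
    (hvj j _).comp x (hasFDerivAt_inv_mulVec_sub A b x).differentiableAt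
  have hterm (i : Fin d) :
      fderiv ℝ (fun y => (c • A.mulVec (v (A⁻¹.mulVec (y - b)))) i) x (Pi.single i 1) =
        c * ∑ j, A i j * fderiv ℝ (fun y => v y j) (A⁻¹.mulVec (x - b))
          (A⁻¹.mulVec (Pi.single i 1)) := by
    simp only [Pi.smul_apply, smul_eq_mul, Matrix.mulVec, dotProduct]
    have hs := (HasFDerivAt.fun_sum (u := Finset.univ)
      fun j _ => (hcomp j).hasFDerivAt.const_mul (A i j)).const_mul c
    refine (congrArg (fun L : (Fin d → ℝ) →L[ℝ] ℝ => L (Pi.single i 1)) hs.fderiv).trans ?_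
    simp only [smul_apply, sum_apply, smul_eq_mul]
    congr 1
    refine Finset.sum_congr rfl fun j _ => ?_
    rw [fderiv_comp_inv_mulVec_sub A b x (f := fun y => v y j) (hvj j _)]
  unfold divv
  simp only [hterm]
  rw [← Finset.mul_sum, Finset.sum_comm]
  congr 1
  refine Finset.sum_congr rfl fun j _ => ?_
  simp only [fderiv_apply_eq_gradv_dotProduct]
  set g := gradv (fun y => v y j) (A⁻¹.mulVec (x - b))
  have hcol : ∑ i, A i j • A⁻¹.mulVec (Pi.single i 1) = Pi.single j 1 := by
    ext k
    have h := congrFun (congrFun (Matrix.nonsing_inv_mul A hA) k) j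
    simp only [Matrix.mul_apply] at h
    simp only [Matrix.mulVec_single_one, Finset.sum_apply, Pi.smul_apply, smul_eq_mul,
      Matrix.col_apply]
    simp only [mul_comm (A _ j), h, Matrix.one_apply, Pi.single_apply]
  rw [← hcol, dotProduct_sum]
  simp only [dotProduct_smul, smul_eq_mul]

/-- Affine invariance of the preconditioned Wasserstein gradient flow of the KL divergence:
if `P` transforms as `P(φ(θ), φ#ρ) = A P(θ,ρ) Aᵀ` under `φ(θ) = Aθ + b`, and `ρ_t` solves
`∂_t ρ_t = ∇·(ρ_t P ∇log(ρ_t/ρ_post))`, then the pushforward `ρ̃_t = φ#ρ_t` solves the same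
equation with target `ρ̃_post = φ#ρ_post`. -/
theorem preconditioned_wasserstein_flow_affine_invariant {d : ℕ}
    (A : Matrix (Fin d) (Fin d) ℝ) (hA : IsUnit A.det) (b : Fin d → ℝ)
    (P : (Fin d → ℝ) → ((Fin d → ℝ) → ℝ) → Matrix (Fin d) (Fin d) ℝ)
    (hPsymm : ∀ θ ρ, IsPosDensity ρ → (P θ ρ).IsSymm)
    (hP : ∀ θ ρ, IsPosDensity ρ →
      P (A.mulVec θ + b) (pushfwd A b ρ) = A * P θ ρ * A.transpose)
    (ρpost : (Fin d → ℝ) → ℝ) (hpostC2 : ContDiff ℝ 2 ρpost)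
    (hpostdens : IsPosDensity ρpost)
    (ρ : ℝ → (Fin d → ℝ) → ℝ)
    (hρdens : ∀ t, IsPosDensity (ρ t))
    (hρC1 : ∀ t, ContDiff ℝ 1 (ρ t))
    (v : ℝ → (Fin d → ℝ) → (Fin d → ℝ))
    (hv : ∀ t θ, v t θ = ρ t θ • (P θ (ρ t)).mulVec
      (gradv (fun x => Real.log (ρ t x)) θ - gradv (fun x => Real.log (ρpost x)) θ))
    (hvC1 : ∀ t, ContDiff ℝ 1 (v t))
    (hflow : ∀ t θ, HasDerivAt (fun s => ρ s θ) (divv (v t) θ) t) :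
    ∀ t θ', HasDerivAt (fun s => pushfwd A b (ρ s) θ')
      (divv (fun x => pushfwd A b (ρ t) x •
        (P x (pushfwd A b (ρ t))).mulVec
          (gradv (fun y => Real.log (pushfwd A b (ρ t) y)) x -
            gradv (fun y => Real.log (pushfwd A b ρpost y)) x)) θ') t := by
  intro t θ'
  have hfield : (fun x => pushfwd A b (ρ t) x •
        (P x (pushfwd A b (ρ t))).mulVec
          (gradv (fun y => Real.log (pushfwd A b (ρ t) y)) x -
            gradv (fun y => Real.log (pushfwd A b ρpost y)) x)) =
      fun x => |A.det|⁻¹ • A.mulVec (v t (A⁻¹.mulVec (x - b))) := by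
    funext x
    have hx : A.mulVec (A⁻¹.mulVec (x - b)) + b = x := by
      rw [Matrix.mulVec_mulVec, Matrix.mul_nonsing_inv A hA, Matrix.one_mulVec, sub_add_cancel]
    have hPx := hP (A⁻¹.mulVec (x - b)) (ρ t) (hρdens t)
    rw [hx] at hPx
    rw [hPx, hv, ← Matrix.mulVec_mulVec, ← Matrix.mulVec_mulVec, Matrix.mulVec_sub A.transpose,
      transpose_mulVec_gradv_log_pushfwd A hA b x (hρdens t).1
        ((hρC1 t).differentiable one_ne_zero),
      transpose_mulVec_gradv_log_pushfwd A hA b x hpostdens.1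
        (hpostC2.differentiable two_ne_zero),
      Matrix.mulVec_smul, smul_smul, mul_comm |A.det|⁻¹]
    rfl
  rw [hfield, divv_smul_mulVec_comp A hA b θ' _ ((hvC1 t).differentiable one_ne_zero), mul_comm]
  exact (hflow t (A⁻¹.mulVec (θ' - b))).mul_const _
end

section
/- Let A ∈ ℝ^{d×d} be invertible, b ∈ ℝ^d, and φ(θ) = Aθ + b. Let κ assign to each pair θ, θ' ∈ ℝ^d and each positive probability density ρ a real number κ(θ,θ',ρ), and let P assign a matrix P(θ,θ',ρ) ∈ ℝ^{d×d}; assume the transformation law κ(φ(θ), φ(θ'), φ#ρ)·P(φ(θ), φ(θ'), φ#ρ) = κ(θ,θ',ρ)·A·P(θ,θ',ρ)·Aᵀ for all θ, θ', ρ. For continuously differentiable positive probability densities ρ, q define the drift f(θ; ρ, q) := ∫ κ(θ,θ',ρ)·P(θ,θ',ρ)·(∇log q(θ') − ∇log ρ(θ'))·ρ(θ') dθ', assuming the integrand is integrable. Then for every θ and every pair of continuously differentiable positive probability densities ρ, ρ_post for which both sides are defined, A·f(θ; ρ, ρ_post) = f(φ(θ); φ#ρ, φ#ρ_post); i.e.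 the mean-field drift of the preconditioned Stein gradient flow is affine invariant. -/
open MeasureTheory

/-- Chain rule for the gradient under an affine change of variables. -/
theorem gradv_comp_affine {d : ℕ} (A : Matrix (Fin d) (Fin d) ℝ) (b : Fin d → ℝ)
    {g : (Fin d → ℝ) → ℝ} {θ : Fin d → ℝ} (hg : DifferentiableAt ℝ g (A.mulVec θ + b)) :
    gradv (fun x => g (A.mulVec x + b)) θ = A.transpose.mulVec (gradv g (A.mulVec θ + b)) := by
  have hφ : HasFDerivAt (fun x => A.mulVec x + b) A.mulVecLin.toContinuousLinearMap θ :=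
    A.mulVecLin.toContinuousLinearMap.hasFDerivAt.add_const b
  have h := (hg.hasFDerivAt.comp θ hφ).fderiv
  ext i
  have h1 : gradv (fun x => g (A.mulVec x + b)) θ i =
      fderiv ℝ g (A.mulVec θ + b) (A.mulVec (Pi.single i 1)) := by
    change fderiv ℝ (g ∘ fun x => A.mulVec x + b) θ (Pi.single i 1) = _
    rw [h]
    rfl
  rw [h1, pi_eq_sum_univ' (A.mulVec (Pi.single i 1)), map_sum]
  simp [Matrix.mulVec, dotProduct, gradv, Pi.single_apply, eq_comm]

theorem pushfwd_apply_affine {d : ℕ} {A : Matrix (Fin d) (Fin d) ℝ} (hA : IsUnit A.det)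
    (b : Fin d → ℝ) (ρ : (Fin d → ℝ) → ℝ) (θ : Fin d → ℝ) :
    pushfwd A b ρ (A.mulVec θ + b) = ρ θ * |A.det|⁻¹ := by
  simp [pushfwd, Matrix.mulVec_mulVec, Matrix.nonsing_inv_mul A hA]

theorem differentiable_pushfwd {d : ℕ} (A : Matrix (Fin d) (Fin d) ℝ) (b : Fin d → ℝ)
    {ρ : (Fin d → ℝ) → ℝ} (hρ : Differentiable ℝ ρ) : Differentiable ℝ (pushfwd A b ρ) := by
  have hψ : Differentiable ℝ fun x : Fin d → ℝ => A⁻¹.mulVec (x - b) :=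
    A⁻¹.mulVecLin.toContinuousLinearMap.differentiable.comp (differentiable_id.sub_const b)
  exact (hρ.comp hψ).mul_const _

/-- The score of a density is the transpose of `A` applied to the score of its pushforward. -/
theorem gradv_log_pushfwd {d : ℕ} {A : Matrix (Fin d) (Fin d) ℝ} (hA : IsUnit A.det)
    (b : Fin d → ℝ) {ρ : (Fin d → ℝ) → ℝ} (hpos : ∀ θ, 0 < ρ θ) (hρ : Differentiable ℝ ρ)
    (θ : Fin d → ℝ) :
    A.transpose.mulVec (gradv (fun x => Real.log (pushfwd A b ρ x)) (A.mulVec θ + b)) =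
      gradv (fun x => Real.log (ρ x)) θ := by
  have hc : |A.det|⁻¹ ≠ 0 := inv_ne_zero (abs_ne_zero.mpr hA.ne_zero)
  have hne : pushfwd A b ρ (A.mulVec θ + b) ≠ 0 := by
    rw [pushfwd_apply_affine hA]
    exact mul_ne_zero (hpos θ).ne' hc
  rw [← gradv_comp_affine A b ((differentiable_pushfwd A b hρ _).log hne)]
  ext i
  simp only [gradv, pushfwd_apply_affine hA, Real.log_mul (hpos _).ne' hc, fderiv_add_const]

/-- Change of variables in a Lebesgue integral under an invertible affine map. -/
theorem integral_eq_abs_det_smul_comp_affine {d : ℕ} {E : Type*} [NormedAddCommGroup E]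
    [NormedSpace ℝ E] {A : Matrix (Fin d) (Fin d) ℝ} (hA : IsUnit A.det) (b : Fin d → ℝ)
    (F : (Fin d → ℝ) → E) :
    ∫ x, F x = ∫ x, |A.det| • F (A.mulVec x + b) := by
  have hinj : Function.Injective fun x => A.mulVec x + b :=
    (add_left_injective b).comp
      (Matrix.mulVec_injective_iff_isUnit.mpr ((Matrix.isUnit_iff_isUnit_det A).mpr hA))
  have hsurj : Function.Surjective fun x => A.mulVec x + b := fun y =>
    ⟨A⁻¹.mulVec (y - b), by simp [Matrix.mulVec_mulVec, Matrix.mul_nonsing_inv A hA]⟩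
  have hφ : ∀ x ∈ Set.univ, HasFDerivWithinAt (fun x => A.mulVec x + b)
      A.mulVecLin.toContinuousLinearMap Set.univ x := fun x _ =>
    (A.mulVecLin.toContinuousLinearMap.hasFDerivAt.add_const b).hasFDerivWithinAt
  have h := integral_image_eq_integral_abs_det_fderiv_smul volume MeasurableSet.univ hφ
    hinj.injOn F
  have hdet : A.mulVecLin.toContinuousLinearMap.det = A.det := LinearMap.det_toLin' A
  simpa [Set.image_univ, hsurj.range_eq, hdet] using h

/-- Affine invariance of the mean-field drift
`f(θ;ρ,q) = ∫ κ(θ,θ',ρ)·P(θ,θ',ρ)·(∇log q(θ') − ∇log ρ(θ'))·ρ(θ') dθ'`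
of the preconditioned Stein gradient flow, under the transformation law
`κ(φθ,φθ',φ#ρ)·P(φθ,φθ',φ#ρ) = κ(θ,θ',ρ)·A·P(θ,θ',ρ)·Aᵀ` for `φ(θ) = Aθ + b`. -/
theorem stein_meanfield_drift_affine_invariant {d : ℕ}
    (A : Matrix (Fin d) (Fin d) ℝ) (hA : IsUnit A.det) (b : Fin d → ℝ)
    (κ : (Fin d → ℝ) → (Fin d → ℝ) → ((Fin d → ℝ) → ℝ) → ℝ)
    (P : (Fin d → ℝ) → (Fin d → ℝ) → ((Fin d → ℝ) → ℝ) → Matrix (Fin d) (Fin d) ℝ)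
    (hκP : ∀ θ θ' ρ, IsPosDensity ρ →
      κ (A.mulVec θ + b) (A.mulVec θ' + b) (pushfwd A b ρ) •
          P (A.mulVec θ + b) (A.mulVec θ' + b) (pushfwd A b ρ) =
        κ θ θ' ρ • (A * P θ θ' ρ * A.transpose))
    (f : (Fin d → ℝ) → ((Fin d → ℝ) → ℝ) → ((Fin d → ℝ) → ℝ) → (Fin d → ℝ))
    (hf : ∀ θ ρ q, f θ ρ q = ∫ θ', ρ θ' •
      (κ θ θ' ρ • P θ θ' ρ).mulVec
        (gradv (fun x => Real.log (q x)) θ' - gradv (fun x => Real.log (ρ x)) θ')) :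
    ∀ (θ : Fin d → ℝ) (ρ ρpost : (Fin d → ℝ) → ℝ),
      IsPosDensity ρ → ContDiff ℝ 1 ρ → IsPosDensity ρpost → ContDiff ℝ 1 ρpost →
      Integrable (fun θ' => ρ θ' • (κ θ θ' ρ • P θ θ' ρ).mulVec
        (gradv (fun x => Real.log (ρpost x)) θ' - gradv (fun x => Real.log (ρ x)) θ')) →
      Integrable (fun θ' => pushfwd A b ρ θ' •
        (κ (A.mulVec θ + b) θ' (pushfwd A b ρ) •
            P (A.mulVec θ + b) θ' (pushfwd A b ρ)).mulVec
          (gradv (fun x => Real.log (pushfwd A b ρpost x)) θ' -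
            gradv (fun x => Real.log (pushfwd A b ρ x)) θ')) →
      A.mulVec (f θ ρ ρpost) = f (A.mulVec θ + b) (pushfwd A b ρ) (pushfwd A b ρpost) := by
  intro θ ρ ρpost hρ hρd hq hqd hint _
  have hdet : |A.det| ≠ 0 := abs_ne_zero.mpr hA.ne_zero
  rw [hf (A.mulVec θ + b), integral_eq_abs_det_smul_comp_affine hA b, hf]
  refine (A.mulVecLin.toContinuousLinearMap.integral_comp_comm hint).symm.trans ?_
  congr 1
  ext1 x
  rw [hκP θ x ρ hρ, pushfwd_apply_affine hA, smul_smul, mul_left_comm, mul_inv_cancel₀ hdet,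
    mul_one, ← gradv_log_pushfwd hA b hρ.1 (hρd.differentiable one_ne_zero),
    ← gradv_log_pushfwd hA b hq.1 (hqd.differentiable one_ne_zero), ← Matrix.mulVec_sub]
  simp [Matrix.smul_mulVec, Matrix.mulVec_mulVec, Matrix.mul_assoc]
end

section
/- Let 0 < α ≤ β, let 0 < λ_min ≤ λ_max, and let C : [0,∞) → ℝ^{d×d} be continuously differentiable with C(t) symmetric for all t, satisfying the Loewner sandwich C(t) − β·C(t)² ⪯ C'(t) ⪯ C(t) − α·C(t)² for all t ≥ 0, and λ_min·I ⪯ C(0) ⪯ λ_max·I. Then for all t ≥ 0, min{λ_min, 1/β}·I ⪯ C(t) ⪯ max{λ_max, 1/α}·I. (In particular, the covariance along the Gaussian approximate Fisher–Rao gradient flow for an α-strongly logconcave, β-smooth target, which satisfies C − βC² ⪯ C' ⪯ C − αC², remains uniformly well conditioned.) -/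
open Matrix in
/-- The quadratic form of an entrywise differentiable matrix family is differentiable. -/
lemma hasDerivWithinAt_dotProduct_mulVec {n : Type*} [Fintype n] {A : ℝ → Matrix n n ℝ}
    {A' : Matrix n n ℝ} {s : Set ℝ} {t : ℝ}
    (h : ∀ i j, HasDerivWithinAt (fun r => A r i j) (A' i j) s t) (v : n → ℝ) :
    HasDerivWithinAt (fun r => v ⬝ᵥ A r *ᵥ v) (v ⬝ᵥ A' *ᵥ v) s t := by
  simp only [dotProduct, mulVec]
  exact HasDerivWithinAt.fun_sum fun i _ =>
    (HasDerivWithinAt.fun_sum fun j _ => (h i j).mul_const (v j)).const_mul (v i)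

/-- A function that is positive on `[0, t)` and vanishes at `t` has nonpositive derivative there. -/
lemma HasDerivWithinAt.nonpos_of_pos_of_eq_zero {f : ℝ → ℝ} {f' t : ℝ} (ht : 0 < t)
    (hf : HasDerivWithinAt f f' (Set.Ici 0) t) (hpos : ∀ s ∈ Set.Ico 0 t, 0 < f s)
    (h0 : f t = 0) : f' ≤ 0 := by
  have hd : HasDerivWithinAt f f' (Set.Ico 0 t) t := hf.mono Set.Ico_subset_Ici_self
  rw [hasDerivWithinAt_iff_tendsto_slope' (by simp)] at hd
  have : (nhdsWithin t (Set.Ico 0 t)).NeBot := by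
    rw [nhdsWithin_Ico_eq_nhdsLT ht]
    infer_instance
  refine le_of_tendsto hd ?_
  filter_upwards [self_mem_nhdsWithin] with s hs
  rw [slope_def_field, h0]
  exact div_nonpos_of_nonneg_of_nonpos (by linarith [hpos s hs]) (by linarith [hs.2])

open Matrix in
/-- A differentiable family of symmetric matrices that starts positive definite, and whose
derivative is positive on the kernel whenever the family touches the boundary of the positive
semidefinite cone, remains positive definite. -/
lemma posDef_of_deriv_pos_on_ker {n : Type*} [Fintype n] {A A' : ℝ → Matrix n n ℝ}
    (hsymm : ∀ t, (A t).IsHermitian)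
    (hderiv : ∀ t, 0 ≤ t → ∀ i j,
      HasDerivWithinAt (fun s => A s i j) (A' t i j) (Set.Ici 0) t)
    (hzero : (A 0).PosDef)
    (hker : ∀ t, 0 ≤ t → ∀ v : n → ℝ, v ≠ 0 → A t *ᵥ v = 0 → 0 < v ⬝ᵥ A' t *ᵥ v)
    {T : ℝ} (hT : 0 ≤ T) : (A T).PosDef := by
  by_contra hcon
  have exists_unit : ∀ t, ¬ (A t).PosDef →
      ∃ v ∈ Metric.sphere (0 : n → ℝ) 1, v ⬝ᵥ A t *ᵥ v ≤ 0 := by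
    intro t ht
    by_contra! h
    refine ht (.of_dotProduct_mulVec_pos (hsymm t) fun v hv => ?_)
    have hnv : 0 < ‖v‖ := norm_pos_iff.2 hv
    have h1 := h (‖v‖⁻¹ • v) (by simp [norm_smul, hnv.ne'])
    rw [mulVec_smul, dotProduct_smul, smul_dotProduct, smul_eq_mul, smul_eq_mul] at h1
    simpa using pos_of_mul_pos_right (pos_of_mul_pos_right h1 (by positivity)) (by positivity)
  let q : ℝ × (n → ℝ) → ℝ := fun p => p.2 ⬝ᵥ A p.1 *ᵥ p.2
  let S : Set (ℝ × (n → ℝ)) := Set.Icc 0 T ×ˢ Metric.sphere 0 1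
  have hq : ContinuousOn q S := by
    have hA : ∀ i j, ContinuousOn (fun p : ℝ × (n → ℝ) => A p.1 i j) S := fun i j =>
      ContinuousOn.comp (t := Set.Ici 0) (fun t ht => (hderiv t ht i j).continuousWithinAt)
        continuousOn_fst fun p hp => hp.1.1
    simp only [q, dotProduct, mulVec]
    exact continuousOn_finsetSum _ fun i _ => ContinuousOn.mul (by fun_prop)
      (continuousOn_finsetSum _ fun j _ => (hA i j).mul (by fun_prop))
  have hS : IsCompact S := isCompact_Icc.prod (isCompact_sphere 0 1)
  have hK : IsCompact (S ∩ q ⁻¹' Set.Iic 0) :=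
    hS.of_isClosed_subset (hq.preimage_isClosed_of_isClosed hS.isClosed isClosed_Iic)
      Set.inter_subset_left
  obtain ⟨w, hw, hqw⟩ := exists_unit T hcon
  obtain ⟨⟨t, v⟩, ⟨⟨ht, hv⟩, hqv⟩, hmin⟩ := hK.exists_isMinOn
    (f := Prod.fst) ⟨(T, w), ⟨⟨hT, le_rfl⟩, hw⟩, hqw⟩ continuousOn_fst
  simp only at ht hv
  have hpd : ∀ s ∈ Set.Ico 0 t, (A s).PosDef := by
    intro s hs
    by_contra h
    obtain ⟨u, hu, hqu⟩ := exists_unit s h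
    exact hs.2.not_ge (hmin (a := (s, u)) ⟨⟨⟨hs.1, hs.2.le.trans ht.2⟩, hu⟩, hqu⟩)
  have hv0 : v ≠ 0 := ne_zero_of_mem_unit_sphere ⟨v, hv⟩
  have ht0 : 0 < t := by
    refine ht.1.lt_of_ne ?_
    rintro rfl
    exact (hzero.dotProduct_mulVec_pos hv0).not_ge (by simpa [q] using hqv)
  have hpsd : (A t).PosSemidef := by
    refine .of_dotProduct_mulVec_nonneg (hsymm t) fun u => ?_
    have hc := ((hasDerivWithinAt_dotProduct_mulVec (hderiv t ht.1) u).mono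
      (Set.Ico_subset_Ici_self (a := t) (b := 0))).continuousWithinAt
    have : (nhdsWithin t (Set.Ico 0 t)).NeBot := by
      rw [nhdsWithin_Ico_eq_nhdsLT ht0]
      infer_instance
    refine ge_of_tendsto hc ?_
    filter_upwards [self_mem_nhdsWithin] with s hs
    exact (hpd s hs).posSemidef.dotProduct_mulVec_nonneg u
  have hq0 : v ⬝ᵥ A t *ᵥ v = 0 := le_antisymm hqv (hpsd.dotProduct_mulVec_nonneg v)
  exact (hker t ht.1 v hv0 ((hpsd.dotProduct_mulVec_zero_iff v).1 hq0)).not_ge <|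
    (hasDerivWithinAt_dotProduct_mulVec (hderiv t ht.1) v).nonpos_of_pos_of_eq_zero ht0
      (fun s hs => (hpd s hs).dotProduct_mulVec_pos hv0) hq0

open Matrix in
lemma dotProduct_riccati_mulVec {n : Type*} [Fintype n] {A : Matrix n n ℝ} {v : n → ℝ} {m : ℝ}
    (hv : A *ᵥ v = m • v) (a : ℝ) :
    v ⬝ᵥ (A - a • (A * A)) *ᵥ v = m * (1 - a * m) * (v ⬝ᵥ v) := by
  rw [sub_mulVec, smul_mulVec, ← mulVec_mulVec, hv, mulVec_smul, hv]
  simp only [dotProduct_sub, dotProduct_smul, smul_eq_mul]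
  ring

open Matrix in
lemma posDef_sub_smul_one_of_lt {n : Type*} [Fintype n] [DecidableEq n] {A : Matrix n n ℝ}
    {l m : ℝ} (hA : (A - l • (1 : Matrix n n ℝ)).PosSemidef) (hm : m < l) :
    (A - m • (1 : Matrix n n ℝ)).PosDef := by
  have h := PosDef.posSemidef_add hA (PosDef.one.smul (sub_pos.2 hm))
  rwa [sub_smul, sub_add_sub_cancel] at h

open Matrix in
lemma posSemidef_sub_smul_one_of_forall_lt {n : Type*} [Fintype n] [DecidableEq n]
    {A : Matrix n n ℝ} {l m : ℝ} (hA : A.IsHermitian) (hl : l < m)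
    (h : ∀ r, l < r → r < m → (A - r • (1 : Matrix n n ℝ)).PosDef) :
    (A - m • (1 : Matrix n n ℝ)).PosSemidef := by
  refine .of_dotProduct_mulVec_nonneg
    (hA.sub (isHermitian_one.smul (IsSelfAdjoint.all m))) fun v => ?_
  have hc : Continuous fun r : ℝ => star v ⬝ᵥ (A - r • (1 : Matrix n n ℝ)) *ᵥ v := by
    simp only [sub_mulVec, smul_mulVec, dotProduct_sub, dotProduct_smul]
    fun_prop
  refine ge_of_tendsto ((hc.tendsto m).mono_left (nhdsWithin_le_nhds (s := Set.Iio m))) ?_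
  filter_upwards [Ioo_mem_nhdsLT hl] with r hr
  exact (h r hr.1 hr.2).posSemidef.dotProduct_mulVec_nonneg v

open Matrix in
/-- Lower barrier for the matrix differential inequality `C - β C² ⪯ C'`. -/
lemma posSemidef_sub_min_smul_one {n : Type*} [Fintype n] [DecidableEq n]
    {C D : ℝ → Matrix n n ℝ} {β l t : ℝ} (hβ : 0 < β) (hl : 0 < l)
    (hsymm : ∀ t, (C t).IsHermitian)
    (hderiv : ∀ t, 0 ≤ t → ∀ i j,
      HasDerivWithinAt (fun s => C s i j) (D t i j) (Set.Ici 0) t)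
    (hlower : ∀ t, 0 ≤ t → (D t - (C t - β • (C t * C t))).PosSemidef)
    (hinit : (C 0 - l • (1 : Matrix n n ℝ)).PosSemidef) (ht : 0 ≤ t) :
    (C t - min l (1 / β) • (1 : Matrix n n ℝ)).PosSemidef := by
  refine posSemidef_sub_smul_one_of_forall_lt (hsymm t) (lt_min hl (one_div_pos.2 hβ))
    fun m hm hlt => ?_
  obtain ⟨h1, h2⟩ := lt_min_iff.1 hlt
  refine posDef_of_deriv_pos_on_ker (A := fun s => C s - m • (1 : Matrix n n ℝ)) (A' := D)
    (fun s => (hsymm s).sub (isHermitian_one.smul (IsSelfAdjoint.all m)))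
    (fun s hs i j => ?_) (posDef_sub_smul_one_of_lt hinit h1) (fun s hs v hv hker => ?_) ht
  · simpa using (hderiv s hs i j).sub_const (m * (1 : Matrix n n ℝ) i j)
  · have hCv : C s *ᵥ v = m • v := by
      simpa [sub_mulVec, smul_mulVec, sub_eq_zero] using hker
    have h3 := (hlower s hs).dotProduct_mulVec_nonneg v
    rw [star_trivial, sub_mulVec, dotProduct_sub, dotProduct_riccati_mulVec hCv] at h3
    rw [lt_div_iff₀ hβ] at h2
    have hvv : 0 < v ⬝ᵥ v := by simpa using dotProduct_star_self_pos_iff.2 hv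
    have : 0 < m * (1 - β * m) * (v ⬝ᵥ v) := mul_pos (mul_pos hm (by linarith)) hvv
    linarith

open Matrix in
/-- Upper barrier for the matrix differential inequality `C' ⪯ C - α C²`. -/
lemma posSemidef_max_smul_one_sub {n : Type*} [Fintype n] [DecidableEq n]
    {C D : ℝ → Matrix n n ℝ} {α l t : ℝ} (hα : 0 < α)
    (hsymm : ∀ t, (C t).IsHermitian)
    (hderiv : ∀ t, 0 ≤ t → ∀ i j,
      HasDerivWithinAt (fun s => C s i j) (D t i j) (Set.Ici 0) t)
    (hupper : ∀ t, 0 ≤ t → ((C t - α • (C t * C t)) - D t).PosSemidef)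
    (hinit : (l • (1 : Matrix n n ℝ) - C 0).PosSemidef) (ht : 0 ≤ t) :
    (max l (1 / α) • (1 : Matrix n n ℝ) - C t).PosSemidef := by
  have neg_form : ∀ (r : ℝ) (B : Matrix n n ℝ), r • (1 : Matrix n n ℝ) - B = -B - (-r) • 1 :=
    fun r B => by rw [neg_smul]; abel
  rw [neg_form] at hinit ⊢
  refine posSemidef_sub_smul_one_of_forall_lt (hsymm t).neg (sub_one_lt _) fun m _ hlt => ?_
  obtain ⟨h1, h2⟩ := max_lt_iff.1 (lt_neg_of_lt_neg hlt)
  refine posDef_of_deriv_pos_on_ker (A := fun s => -C s - m • (1 : Matrix n n ℝ))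
    (A' := fun s => -D s)
    (fun s => (hsymm s).neg.sub (isHermitian_one.smul (IsSelfAdjoint.all m)))
    (fun s hs i j => ?_) (posDef_sub_smul_one_of_lt hinit (lt_neg_of_lt_neg h1))
    (fun s hs v hv hker => ?_) ht
  · simpa using (hderiv s hs i j).fun_neg.sub_const (m * (1 : Matrix n n ℝ) i j)
  · have hCv : C s *ᵥ v = (-m) • v := by
      rw [sub_mulVec, neg_mulVec, smul_mulVec, one_mulVec, sub_eq_zero] at hker
      rw [neg_smul, ← hker, neg_neg]
    have h3 := (hupper s hs).dotProduct_mulVec_nonneg v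
    rw [star_trivial, sub_mulVec, dotProduct_sub, dotProduct_riccati_mulVec hCv] at h3
    have hm : 0 < -m := (one_div_pos.2 hα).trans h2
    rw [div_lt_iff₀ hα] at h2
    have hvv : 0 < v ⬝ᵥ v := by simpa using dotProduct_star_self_pos_iff.2 hv
    have : 0 < -m * (α * -m - 1) * (v ⬝ᵥ v) := mul_pos (mul_pos hm (by linarith)) hvv
    rw [neg_mulVec, dotProduct_neg]
    linarith

/-- Well-conditioning of the covariance along the Gaussian approximate Fisher–Rao gradient
flow: if the symmetric matrix family `C(t)` satisfies the Loewner sandwich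
`C − βC² ⪯ C' ⪯ C − αC²` on `[0,∞)` and `λ_min I ⪯ C(0) ⪯ λ_max I`, then
`min{λ_min, 1/β} I ⪯ C(t) ⪯ max{λ_max, 1/α} I` for all `t ≥ 0`. -/
theorem covariance_well_conditioned {d : ℕ}
    (α β lmin lmax : ℝ) (hα : 0 < α) (hαβ : α ≤ β) (hlmin : 0 < lmin) (hl : lmin ≤ lmax)
    (C D : ℝ → Matrix (Fin d) (Fin d) ℝ)
    (hsymm : ∀ t, (C t).IsSymm)
    -- C is continuously differentiable on [0,∞) with derivative D
    (hderiv : ∀ t, 0 ≤ t → ∀ i j,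
      HasDerivWithinAt (fun s => C s i j) (D t i j) (Set.Ici 0) t)
    (hDcont : ∀ i j, ContinuousOn (fun t => D t i j) (Set.Ici 0))
    -- the Loewner sandwich C − βC² ⪯ C' ⪯ C − αC²
    (hlower : ∀ t, 0 ≤ t → (D t - (C t - β • (C t * C t))).PosSemidef)
    (hupper : ∀ t, 0 ≤ t → ((C t - α • (C t * C t)) - D t).PosSemidef)
    -- λ_min I ⪯ C(0) ⪯ λ_max I
    (hinit_lb : (C 0 - lmin • (1 : Matrix (Fin d) (Fin d) ℝ)).PosSemidef)
    (hinit_ub : (lmax • (1 : Matrix (Fin d) (Fin d) ℝ) - C 0).PosSemidef) :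
    ∀ t, 0 ≤ t →
      (C t - min lmin (1 / β) • (1 : Matrix (Fin d) (Fin d) ℝ)).PosSemidef ∧
      (max lmax (1 / α) • (1 : Matrix (Fin d) (Fin d) ℝ) - C t).PosSemidef := by
  have herm : ∀ t, (C t).IsHermitian := fun t =>
    (Matrix.conjTranspose_eq_transpose_of_trivial (C t)).trans (hsymm t)
  exact fun t ht =>
    ⟨posSemidef_sub_min_smul_one (hα.trans_le hαβ) hlmin herm hderiv hlower hinit_lb ht,
      posSemidef_max_smul_one_sub hα herm hderiv hupper hinit_ub ht⟩
end
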